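/- Let q be a power of a prime and F_q the finite field with q elements. Let A ⊆ F_q with |A| ≥ 2, and suppose there is a constant C > 0 such that for every proper subfield G of F_q and all elements c, d ∈ F_q one has |A ∩ (cG + d)| ≤ C·max{|G|^{1/2}, |A|^{51/52}}. Then there is a constant c' > 0 depending only on C such that L(A × A) ≥ c'·min{|A|^{2 + 1/52}, q^{2/95}|A|^{2 - 2/95}}. -/

import Mathlib

open scoped Classical Pointwise

noncomputable section

namespace STP

variable {F : Type} [Field F]

def collinearTriples (A B : Finset F) : ℕ :=
  (((A ×ˢ A ×ˢ A) ×ˢ (B ×ˢ B ×ˢ B)).filter fun x =>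
    (x.1.2.1 - x.1.1) * (x.2.2.2 - x.2.1) = (x.1.2.2 - x.1.1) * (x.2.2.1 - x.2.1)).card

def IsLine (l : Set (F × F)) : Prop :=
  ∃ a b c : F, (a, b) ≠ (0, 0) ∧ l = {p : F × F | a * p.1 + b * p.2 = c}

def incidences (P : Finset (F × F)) (L : Finset (Set (F × F))) : ℕ :=
  ((P ×ˢ L).filter fun x => x.1 ∈ x.2).card

def kIncidences (P : Finset (F × F)) (L : Finset (Set (F × F))) (k : ℕ) : ℕ :=
  (((Fintype.piFinset fun _ : Fin k => P) ×ˢ L).filter fun x => ∀ i, x.1 i ∈ x.2).card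

def numLines (P : Finset (F × F)) : ℕ :=
  Set.ncard {l : Set (F × F) | IsLine l ∧ 2 ≤ (P.filter (· ∈ l)).card}

def addEnergy (X Y : Finset F) : ℕ :=
  (((X ×ˢ X) ×ˢ (Y ×ˢ Y)).filter fun t => t.1.1 + t.2.1 = t.1.2 + t.2.2).card

def mulEnergy (A : Finset F) : ℕ :=
  (((A ×ˢ A) ×ˢ (A ×ˢ A)).filter fun t => t.1.1 * t.2.1 = t.1.2 * t.2.2).card

def quotSet (X : Finset F) : Set F :=
  {r : F | ∃ x1 ∈ X, ∃ x2 ∈ X, ∃ x3 ∈ X, ∃ x4 ∈ X, x3 ≠ x4 ∧ r = (x1 - x2) / (x3 - x4)}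

def subfieldCond (A : Finset F) (C bound : ℝ) : Prop :=
  ∀ G : Subfield F, G ≠ ⊤ → ∀ c d : F,
    ((A.filter fun x => ∃ g ∈ G, x = c * g + d).card : ℝ) ≤
      C * max ((Nat.card G : ℝ) ^ ((1:ℝ)/2)) bound

def linesOf [Fintype F] (P : Finset (F × F)) : Finset (Set (F × F)) :=
  Set.Finite.toFinset (Set.toFinite {l : Set (F × F) | IsLine l ∧ 2 ≤ (P.filter (· ∈ l)).card})

def tripleCount [Fintype F] (P : Finset (F × F)) : ℕ :=
  ∑ l ∈ linesOf P, ((P.filter (· ∈ l)).card) ^ 3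


/-- Covering lemma -/
lemma cover_lemma (Y Y1 W : Finset F) (v v0 : F) (hv0 : v0 ≠ 0) (L : ℝ) (hL : 0 < L)
    (hY1 : Y1 ⊆ Y) (h1 : (19/20 : ℝ) * Y.card ≤ Y1.card) (hW : (W.card : ℝ) ≤ L * Y.card)
    (hbad : (((Y ×ˢ Y).filter fun p => v * p.1 - v0 * p.2 ∉ W).card : ℝ) ≤ (Y.card : ℝ)^2 / 100) :
    ∃ T Z : Finset F, Z ⊆ Y ∧ (19/20 : ℝ) * Y.card ≤ Z.card ∧ (T.card : ℝ) ≤ 40 * L ∧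
      ∀ z ∈ Z, ∃ τ ∈ T, ∃ y ∈ Y1, v * z = τ + v0 * y := by
  rcases Y.eq_empty_or_nonempty with hYe | hYne
  · subst hYe
    exact ⟨∅, ∅, by simp, by simp, by simp; positivity, by simp⟩
  have hYpos : (0:ℝ) < Y.card := by exact_mod_cast hYne.card_pos
  set N : ℝ := (Y.card : ℝ) with hN
  set κ : ℝ := N / (40 * L) with hκ
  have hκpos : 0 < κ := by positivity
  let cov : Finset F → Finset F := fun T => Y.filter fun z => ∃ τ ∈ T, ∃ y ∈ Y1, v * z = τ + v0 * y
  obtain ⟨T, hTW, hTmax⟩ := Finset.exists_max_image W.powerset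
    (fun T => ((cov T).card : ℝ) - κ * T.card) ⟨∅, by simp⟩
  have hT0 := hTmax ∅ (by simp)
  have hcov0 : cov ∅ = ∅ := by simp [cov]
  have hcovle : ((cov T).card : ℝ) ≤ N := by
    rw [hN]
    exact Nat.cast_le.mpr (Finset.card_le_card (Finset.filter_subset _ _))
  have hTcard : (T.card : ℝ) ≤ 40 * L := by
    rw [hcov0] at hT0
    simp only [Finset.card_empty, Nat.cast_zero, mul_zero, sub_zero] at hT0
    have h2 : κ * T.card ≤ N := by linarith
    rw [hκ, div_mul_eq_mul_div, div_le_iff₀ (by positivity)] at h2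
    exact le_of_mul_le_mul_left h2 hYpos
  refine ⟨T, cov T, Finset.filter_subset _ _, ?_, hTcard, ?_⟩
  swap
  · intro z hz
    exact (Finset.mem_filter.mp hz).2
  by_contra hcon
  push Not at hcon
  set U := Y \ cov T with hU
  have hUcard : (U.card : ℝ) = N - (cov T).card := by
    have := Finset.card_sdiff_add_card_eq_card (s := cov T) (t := Y) (Finset.filter_subset _ _)
    rw [hU, hN, ← this]; push_cast; ring
  have hUbig : N / 20 < U.card := by rw [hUcard]; linarith
  have hUN : (U.card : ℝ) ≤ N := by rw [hUcard]; linarith [Nat.cast_nonneg (α := ℝ) (cov T).card]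
  set E := (U ×ˢ Y1).filter fun p => v * p.1 - v0 * p.2 ∈ W with hE
  have hEcard : (U.card : ℝ) * Y1.card - N^2/100 ≤ E.card := by
    have h3 := Finset.card_filter_add_card_filter_not (s := U ×ˢ Y1) (fun p => v * p.1 - v0 * p.2 ∈ W)
    have h4 : ((U ×ˢ Y1).filter fun p => ¬ (v * p.1 - v0 * p.2 ∈ W)).card ≤
      ((Y ×ˢ Y).filter fun p => v * p.1 - v0 * p.2 ∉ W).card := by
      apply Finset.card_le_card
      apply Finset.filter_subset_filter
      exact Finset.product_subset_product Finset.sdiff_subset hY1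
    rw [Finset.card_product] at h3
    have h3' : (E.card : ℝ) + (((U ×ˢ Y1).filter fun p => ¬ (v * p.1 - v0 * p.2 ∈ W)).card : ℝ)
      = U.card * Y1.card := by exact_mod_cast h3
    have h4' : ((((U ×ˢ Y1).filter fun p => ¬ (v * p.1 - v0 * p.2 ∈ W)).card : ℕ) : ℝ) ≤ _ := Nat.cast_le.mpr h4
    linarith
  have hfib : (E.card : ℝ) ≤ W.card * κ := by
    have h5 := Finset.card_eq_sum_card_fiberwise (s := E) (t := W)
      (f := fun p => v * p.1 - v0 * p.2) (by
        intro p hp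
        exact (Finset.mem_filter.mp hp).2)
    rw [h5]; push_cast
    rw [← nsmul_eq_mul]
    apply Finset.sum_le_card_nsmul
    intro w hw
    have hmax := hTmax (insert w T) (by
      rw [Finset.mem_powerset] at hTW ⊢
      exact Finset.insert_subset hw hTW)
    have hins : ((insert w T).card : ℝ) ≤ T.card + 1 := by exact_mod_cast Finset.card_insert_le w T
    have hsub : cov T ⊆ cov (insert w T) := by
      intro z hz
      simp only [cov, Finset.mem_filter] at hz ⊢
      obtain ⟨hz1, τ, hτ, h⟩ := hz
      exact ⟨hz1, τ, Finset.mem_insert_of_mem hτ, h⟩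
    have hf : (E.filter fun p => v * p.1 - v0 * p.2 = w).card ≤ (cov (insert w T) \ cov T).card := by
      apply Finset.card_le_card_of_injOn (fun p => p.1)
      · intro p hp
        simp only [Finset.coe_filter, Set.mem_ofPred_eq, hE, Finset.mem_filter, Finset.mem_product, hU,
          Finset.mem_sdiff] at hp
        obtain ⟨⟨⟨⟨hp1, hp2⟩, hp3⟩, hp4⟩, hp5⟩ := hp
        simp only [Finset.coe_sdiff, Set.mem_sdiff, Finset.mem_coe]
        refine ⟨?_, hp2⟩
        simp only [cov, Finset.mem_filter]
        exact ⟨hp1, w, Finset.mem_insert_self _ _, p.2, hp3, by rw [← hp5]; ring⟩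
      · intro p hp p' hp' hpp
        simp only [Finset.coe_filter, Set.mem_ofPred_eq] at hp hp'
        have e1 := hp.2
        have e2 := hp'.2
        have hpp' : p.1 = p'.1 := hpp
        rw [← e2, hpp'] at e1
        have : v0 * p.2 = v0 * p'.2 := by linear_combination -e1
        exact Prod.ext hpp' (mul_left_cancel₀ hv0 this)
    have hsd : ((cov (insert w T) \ cov T).card : ℝ) = (cov (insert w T)).card - (cov T).card := by
      have := Finset.card_sdiff_add_card_eq_card hsub
      rw [← this]; push_cast; ring
    have hf' : ((E.filter fun p => v * p.1 - v0 * p.2 = w).card : ℝ) ≤ _ := Nat.cast_le.mpr hf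
    rw [hsd] at hf'
    have : κ * (insert w T).card ≤ κ * (T.card + 1) := mul_le_mul_of_nonneg_left hins hκpos.le
    linarith
  have h6 : (W.card : ℝ) * κ ≤ N^2/40 := by
    calc (W.card : ℝ) * κ ≤ (L * N) * κ := by gcongr
      _ = N^2/40 := by rw [hκ]; field_simp
  have h7 : (U.card : ℝ) * (19/20 * N) ≤ U.card * Y1.card := by gcongr
  nlinarith

set_option linter.unusedSectionVars false

lemma plu3 (Y : Finset F) (K : ℝ) (hY : Y.Nonempty) (h : ((Y - Y).card : ℝ) ≤ K * Y.card) :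
    (((Y + Y + Y) - (Y + Y + Y)).card : ℝ) ≤ K ^ 6 * Y.card := by
  have h1 := Finset.pluennecke_ruzsa_inequality_nsmul_sub_nsmul_sub hY Y 3 3
  rw [succ_nsmul, succ_nsmul, one_nsmul] at h1
  have hpos : (0:ℝ) < Y.card := by exact_mod_cast hY.card_pos
  have h2 : (((Y + Y + Y) - (Y + Y + Y)).card : ℝ) ≤ (((Y - Y).card : ℝ) / Y.card) ^ 6 * Y.card := by
    have h3 := (NNRat.cast_le (K := ℝ)).mpr h1
    push_cast at h3
    exact h3
  refine h2.trans ?_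
  gcongr
  rwa [div_le_iff₀ hpos]

lemma plu2 (Y : Finset F) (K : ℝ) (hY : Y.Nonempty) (h : ((Y - Y).card : ℝ) ≤ K * Y.card) :
    (((Y + Y) - (Y + Y)).card : ℝ) ≤ K ^ 4 * Y.card := by
  have h1 := Finset.pluennecke_ruzsa_inequality_nsmul_sub_nsmul_sub hY Y 2 2
  rw [succ_nsmul, one_nsmul] at h1
  have hpos : (0:ℝ) < Y.card := by exact_mod_cast hY.card_pos
  have h2 : (((Y + Y) - (Y + Y)).card : ℝ) ≤ (((Y - Y).card : ℝ) / Y.card) ^ 4 * Y.card := by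
    have h3 := (NNRat.cast_le (K := ℝ)).mpr h1
    push_cast at h3
    exact h3
  refine h2.trans ?_
  gcongr
  rwa [div_le_iff₀ hpos]

/-- If all values of a map lie in `T + c * D` the image is small. -/
lemma card_image_bound {α : Type} (P : Finset α) (f : α → F) (T D : Finset F) (c : F)
    (h : ∀ p ∈ P, ∃ τ ∈ T, ∃ d ∈ D, f p = τ + c * d) :
    (P.image f).card ≤ T.card * D.card := by
  calc (P.image f).card ≤ ((T ×ˢ D).image fun p => p.1 + c * p.2).card := by
        apply Finset.card_le_card
        intro x hx
        obtain ⟨p, hp, rfl⟩ := Finset.mem_image.mp hx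
        obtain ⟨τ, hτ, d, hd, he⟩ := h p hp
        exact Finset.mem_image.mpr ⟨(τ, d), by simp [hτ, hd], he.symm⟩
    _ ≤ (T ×ˢ D).card := Finset.card_image_le
    _ = T.card * D.card := Finset.card_product _ _

/-- cover property -/
def Cov (Y : Finset F) (v0 : F) (L : ℝ) : Prop :=
  ∀ v ∈ Y, ∀ Y1 ⊆ Y, (19/20 : ℝ) * Y.card ≤ Y1.card →
    ∃ T Z : Finset F, Z ⊆ Y ∧ (19/20 : ℝ) * Y.card ≤ Z.card ∧ (T.card : ℝ) ≤ L ∧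
      ∀ z ∈ Z, ∃ τ ∈ T, ∃ y ∈ Y1, v * z = τ + v0 * y

lemma inter_big (Y Z1 Z2 : Finset F) (a b : ℝ) (h1 : Z1 ⊆ Y) (h2 : Z2 ⊆ Y)
    (c1 : (1 - a) * Y.card ≤ Z1.card) (c2 : (1 - b) * Y.card ≤ Z2.card) :
    (1 - (a + b)) * Y.card ≤ (Z1 ∩ Z2).card := by
  have h := Finset.card_union_add_card_inter Z1 Z2
  have h3 : (Z1 ∪ Z2).card ≤ Y.card := Finset.card_le_card (Finset.union_subset h1 h2)
  have h' : ((Z1 ∪ Z2).card : ℝ) + (Z1 ∩ Z2).card = Z1.card + Z2.card := by exact_mod_cast h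
  have h3' : ((Z1 ∪ Z2).card : ℝ) ≤ Y.card := by exact_mod_cast h3
  linarith

lemma inter4_big (Y Z1 Z2 Z3 Z4 : Finset F) (h1 : Z1 ⊆ Y) (h2 : Z2 ⊆ Y) (h3 : Z3 ⊆ Y) (h4 : Z4 ⊆ Y)
    (c1 : (19/20 : ℝ) * Y.card ≤ Z1.card) (c2 : (19/20 : ℝ) * Y.card ≤ Z2.card)
    (c3 : (19/20 : ℝ) * Y.card ≤ Z3.card) (c4 : (19/20 : ℝ) * Y.card ≤ Z4.card) :
    (4/5 : ℝ) * Y.card ≤ ((Z1 ∩ Z2) ∩ (Z3 ∩ Z4)).card := by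
  have a := inter_big Y Z1 Z2 (1/20) (1/20) h1 h2 (by linarith) (by linarith)
  have b := inter_big Y Z3 Z4 (1/20) (1/20) h3 h4 (by linarith) (by linarith)
  have c := inter_big Y (Z1 ∩ Z2) (Z3 ∩ Z4) _ _ (Finset.inter_subset_left.trans h1)
    (Finset.inter_subset_left.trans h3) a b
  linarith

lemma card_sub_le_real (S T : Finset F) (a b : ℝ) (ha : 0 ≤ a) (h1 : (S.card : ℝ) ≤ a)
    (h2 : (T.card : ℝ) ≤ b) : ((S - T).card : ℝ) ≤ a * b := by
  have : ((S - T).card : ℝ) ≤ S.card * T.card := by exact_mod_cast Finset.card_sub_le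
  exact this.trans (by gcongr)

lemma card_add_le_real (S T : Finset F) (a b : ℝ) (ha : 0 ≤ a) (h1 : (S.card : ℝ) ≤ a)
    (h2 : (T.card : ℝ) ≤ b) : ((S + T).card : ℝ) ≤ a * b := by
  have : ((S + T).card : ℝ) ≤ S.card * T.card := by exact_mod_cast Finset.card_add_le
  exact this.trans (by gcongr)

/-- injectivity outside the quotient set -/
lemma inj_image (Y Z : Finset F) (hZ : Z ⊆ Y) (ξ d : F) (hd : d ≠ 0) (hξ : ξ ∉ quotSet Y) :
    ((Z ×ˢ Z).image fun p => d * p.1 + d * ξ * p.2).card = Z.card ^ 2 := by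
  rw [Finset.card_image_of_injOn, Finset.card_product, sq]
  intro p hp p' hp' he
  simp only [Finset.coe_product, Set.mem_prod, Finset.mem_coe] at hp hp'
  have he' : p.1 + ξ * p.2 = p'.1 + ξ * p'.2 := by
    have he2 : d * p.1 + d * ξ * p.2 = d * p'.1 + d * ξ * p'.2 := he
    apply mul_left_cancel₀ hd
    linear_combination he2
  by_cases h2 : p.2 = p'.2
  · rw [h2] at he'
    exact Prod.ext (add_right_cancel he') h2
  · exfalso
    apply hξ
    refine ⟨p.1, hZ hp.1, p'.1, hZ hp'.1, p'.2, hZ hp'.2, p.2, hZ hp.2, fun h => h2 h.symm, ?_⟩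
    rw [eq_div_iff (sub_ne_zero.mpr fun h => h2 h.symm)]
    linear_combination -he'

lemma case1 (Y : Finset F) (v0 : F) (K L : ℝ) (hY : Y.Nonempty) (hL : 0 ≤ L)
    (hK : ((Y - Y).card : ℝ) ≤ K * Y.card) (hc : Cov Y v0 L)
    (x1 x2 x3 x4 : F) (h1 : x1 ∈ Y) (h2 : x2 ∈ Y) (h3 : x3 ∈ Y) (h4 : x4 ∈ Y) (hne : x3 ≠ x4)
    (hξ : (x1 - x2) / (x3 - x4) + 1 ∉ quotSet Y) :
    (Y.card : ℝ) ≤ 2 * L ^ 6 * K ^ 6 := by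
  have hpos : (0:ℝ) < Y.card := by exact_mod_cast hY.card_pos
  have hYY : (19/20 : ℝ) * Y.card ≤ Y.card := by linarith
  obtain ⟨T1, Z1, s1, c1, t1, m1⟩ := hc x1 h1 Y subset_rfl hYY
  obtain ⟨T2, Z2, s2, c2, t2, m2⟩ := hc x2 h2 Y subset_rfl hYY
  obtain ⟨T3, Z3, s3, c3, t3, m3⟩ := hc x3 h3 Y subset_rfl hYY
  obtain ⟨T4, Z4, s4, c4, t4, m4⟩ := hc x4 h4 Y subset_rfl hYY
  set Z := (Z1 ∩ Z2) ∩ (Z3 ∩ Z4) with hZ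
  have cZ := inter4_big Y Z1 Z2 Z3 Z4 s1 s2 s3 s4 c1 c2 c3 c4
  have hd : x3 - x4 ≠ 0 := sub_ne_zero.mpr hne
  have hZY : Z ⊆ Y := fun z hz => by
    simp only [hZ, Finset.mem_inter] at hz
    exact s1 hz.1.1
  have hinj := inj_image Y Z hZY _ _ hd hξ
  have hb := card_image_bound (Z ×ˢ Z)
    (fun p => (x3 - x4) * p.1 + (x3 - x4) * ((x1 - x2) / (x3 - x4) + 1) * p.2)
    ((T3 - T4) + ((T3 - T4) + (T1 - T2))) ((Y + Y + Y) - (Y + Y + Y)) v0 (by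
      rintro ⟨z, z'⟩ hp
      rw [Finset.mem_product] at hp
      simp only [hZ, Finset.mem_inter] at hp
      obtain ⟨⟨-, a3, a4⟩, ⟨b1, b2⟩, b3, b4⟩ := hp
      obtain ⟨τ3, hτ3, y3, hy3, e3⟩ := m3 z a3
      obtain ⟨τ4, hτ4, y4, hy4, e4⟩ := m4 z a4
      obtain ⟨σ1, hσ1, w1, hw1, f1⟩ := m1 z' b1
      obtain ⟨σ2, hσ2, w2, hw2, f2⟩ := m2 z' b2
      obtain ⟨σ3, hσ3, w3, hw3, f3⟩ := m3 z' b3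
      obtain ⟨σ4, hσ4, w4, hw4, f4⟩ := m4 z' b4
      refine ⟨(τ3 - τ4) + ((σ3 - σ4) + (σ1 - σ2)), ?_, (y3 + w3 + w1) - (y4 + w4 + w2), ?_, ?_⟩
      · exact Finset.add_mem_add (Finset.sub_mem_sub hτ3 hτ4)
          (Finset.add_mem_add (Finset.sub_mem_sub hσ3 hσ4) (Finset.sub_mem_sub hσ1 hσ2))
      · exact Finset.sub_mem_sub (Finset.add_mem_add (Finset.add_mem_add hy3 hw3) hw1)
          (Finset.add_mem_add (Finset.add_mem_add hy4 hw4) hw2)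
      · have : (x3 - x4) * ((x1 - x2) / (x3 - x4) + 1) = (x1 - x2) + (x3 - x4) := by
          field_simp
        simp only [this]
        linear_combination e3 - e4 + f1 - f2 + f3 - f4)
  rw [hinj] at hb
  have hT : (((T3 - T4) + ((T3 - T4) + (T1 - T2))).card : ℝ) ≤ (L * L) * ((L * L) * (L * L)) :=
    card_add_le_real _ _ _ _ (by positivity) (card_sub_le_real _ _ _ _ hL t3 t4)
      (card_add_le_real _ _ _ _ (by positivity) (card_sub_le_real _ _ _ _ hL t3 t4)
        (card_sub_le_real _ _ _ _ hL t1 t2))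
  have hP := plu3 Y K hY hK
  have hb' : (Z.card : ℝ) ^ 2 ≤ ((L * L) * ((L * L) * (L * L))) * (K ^ 6 * Y.card) := by
    have hb2 : (Z.card : ℝ) ^ 2 ≤ (((T3 - T4) + ((T3 - T4) + (T1 - T2))).card : ℝ) *
        (((Y + Y + Y) - (Y + Y + Y)).card : ℝ) := by exact_mod_cast hb
    exact hb2.trans (mul_le_mul hT hP (by positivity) (by positivity))
  have hsq : ((4/5 : ℝ) * Y.card) ^ 2 ≤ (Z.card : ℝ) ^ 2 := by gcongr
  have : (Y.card : ℝ) * Y.card ≤ (2 * L ^ 6 * K ^ 6) * Y.card := by nlinarith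
  exact le_of_mul_le_mul_right this hpos

lemma case2 (Y : Finset F) (v0 : F) (K L : ℝ) (hY : Y.Nonempty) (hL : 0 ≤ L)
    (hK : ((Y - Y).card : ℝ) ≤ K * Y.card) (hc : Cov Y v0 L)
    (x1 x2 x3 x4 y y' : F) (h1 : x1 ∈ Y) (h2 : x2 ∈ Y) (h3 : x3 ∈ Y) (h4 : x4 ∈ Y) (hne : x3 ≠ x4)
    (hy : y ∈ Y) (hy' : y' ∈ Y) (hy0 : y' ≠ 0)
    (hξ : (y / y') * ((x1 - x2) / (x3 - x4)) ∉ quotSet Y) :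
    (Y.card : ℝ) ≤ 2 * L ^ 8 * K ^ 4 := by
  have hpos : (0:ℝ) < Y.card := by exact_mod_cast hY.card_pos
  have hYY : (19/20 : ℝ) * Y.card ≤ Y.card := by linarith
  obtain ⟨R, Q, sQ, cQ, tR, mQ⟩ := hc y hy Y subset_rfl hYY
  obtain ⟨R', Q', sQ', cQ', tR', mQ'⟩ := hc y' hy' Y subset_rfl hYY
  obtain ⟨T1, Z1, s1, c1, t1, m1⟩ := hc x1 h1 Q sQ cQ
  obtain ⟨T2, Z2, s2, c2, t2, m2⟩ := hc x2 h2 Q sQ cQ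
  obtain ⟨T3, Z3, s3, c3, t3, m3⟩ := hc x3 h3 Q' sQ' cQ'
  obtain ⟨T4, Z4, s4, c4, t4, m4⟩ := hc x4 h4 Q' sQ' cQ'
  set Z := (Z1 ∩ Z2) ∩ (Z3 ∩ Z4) with hZ
  have cZ := inter4_big Y Z1 Z2 Z3 Z4 s1 s2 s3 s4 c1 c2 c3 c4
  have hd0 : x3 - x4 ≠ 0 := sub_ne_zero.mpr hne
  have hd : y' * (x3 - x4) ≠ 0 := mul_ne_zero hy0 hd0
  have hZY : Z ⊆ Y := fun z hz => by
    simp only [hZ, Finset.mem_inter] at hz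
    exact s1 hz.1.1
  have hinj := inj_image Y Z hZY _ _ hd hξ
  let C : F → Finset F → Finset F → Finset F := fun u S T => (S ×ˢ T).image fun p => u * p.1 + v0 * p.2
  have hC : ∀ u S T, (S.card : ℝ) ≤ L → (T.card : ℝ) ≤ L → ((C u S T).card : ℝ) ≤ L * L := by
    intro u S T hS hT
    have : (C u S T).card ≤ S.card * T.card := Finset.card_image_le.trans (Finset.card_product _ _).le
    calc ((C u S T).card : ℝ) ≤ S.card * T.card := by exact_mod_cast this
      _ ≤ L * L := by gcongr
  have hCm : ∀ u S T, ∀ a ∈ S, ∀ b ∈ T, u * a + v0 * b ∈ C u S T := by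
    intro u S T a ha b hb
    exact Finset.mem_image.mpr ⟨(a, b), by simp [ha, hb], rfl⟩
  have hb := card_image_bound (Z ×ˢ Z)
    (fun p => (y' * (x3 - x4)) * p.1 + (y' * (x3 - x4)) * ((y / y') * ((x1 - x2) / (x3 - x4))) * p.2)
    ((C y' T3 R' - C y' T4 R') + (C y T1 R - C y T2 R)) ((Y + Y) - (Y + Y)) (v0 * v0) (by
      rintro ⟨z, z'⟩ hp
      rw [Finset.mem_product] at hp
      simp only [hZ, Finset.mem_inter] at hp
      obtain ⟨⟨-, a3, a4⟩, ⟨b1, b2⟩, b3, b4⟩ := hp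
      obtain ⟨τ3, hτ3, y3, hy3, e3⟩ := m3 z a3
      obtain ⟨τ4, hτ4, y4, hy4, e4⟩ := m4 z a4
      obtain ⟨σ1, hσ1, w1, hw1, f1⟩ := m1 z' b1
      obtain ⟨σ2, hσ2, w2, hw2, f2⟩ := m2 z' b2
      obtain ⟨τ3', hτ3', y3', hy3', e3'⟩ := mQ' y3 hy3
      obtain ⟨τ4', hτ4', y4', hy4', e4'⟩ := mQ' y4 hy4
      obtain ⟨σ1', hσ1', w1', hw1', f1'⟩ := mQ w1 hw1
      obtain ⟨σ2', hσ2', w2', hw2', f2'⟩ := mQ w2 hw2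
      refine ⟨((y' * τ3 + v0 * τ3') - (y' * τ4 + v0 * τ4')) +
        ((y * σ1 + v0 * σ1') - (y * σ2 + v0 * σ2')), ?_, (y3' + w1') - (y4' + w2'), ?_, ?_⟩
      · exact Finset.add_mem_add
          (Finset.sub_mem_sub (hCm _ _ _ _ hτ3 _ hτ3') (hCm _ _ _ _ hτ4 _ hτ4'))
          (Finset.sub_mem_sub (hCm _ _ _ _ hσ1 _ hσ1') (hCm _ _ _ _ hσ2 _ hσ2'))
      · exact Finset.sub_mem_sub (Finset.add_mem_add hy3' hw1') (Finset.add_mem_add hy4' hw2')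
      · have : (y' * (x3 - x4)) * ((y / y') * ((x1 - x2) / (x3 - x4))) = y * (x1 - x2) := by
          field_simp
        simp only [this]
        linear_combination y' * e3 - y' * e4 + y * f1 - y * f2 + v0 * e3' - v0 * e4' + v0 * f1' - v0 * f2')
  rw [hinj] at hb
  have hT : (((C y' T3 R' - C y' T4 R') + (C y T1 R - C y T2 R)).card : ℝ) ≤
      ((L * L) * (L * L)) * ((L * L) * (L * L)) :=
    card_add_le_real _ _ _ _ (by positivity)
      (card_sub_le_real _ _ _ _ (by positivity) (hC _ _ _ t3 tR') (hC _ _ _ t4 tR'))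
      (card_sub_le_real _ _ _ _ (by positivity) (hC _ _ _ t1 tR) (hC _ _ _ t2 tR))
  have hP := plu2 Y K hY hK
  have hb' : (Z.card : ℝ) ^ 2 ≤ (((L * L) * (L * L)) * ((L * L) * (L * L))) * (K ^ 4 * Y.card) := by
    have hb2 : (Z.card : ℝ) ^ 2 ≤ (((C y' T3 R' - C y' T4 R') + (C y T1 R - C y T2 R)).card : ℝ) *
        (((Y + Y) - (Y + Y)).card : ℝ) := by exact_mod_cast hb
    exact hb2.trans (mul_le_mul hT hP (by positivity) (by positivity))
  have hsq : ((4/5 : ℝ) * Y.card) ^ 2 ≤ (Z.card : ℝ) ^ 2 := by gcongr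
  have : (Y.card : ℝ) * Y.card ≤ (2 * L ^ 8 * K ^ 4) * Y.card := by nlinarith
  exact le_of_mul_le_mul_right this hpos

/-- every ratio has a large energy -/
lemma case3 (Y : Finset F) (v0 : F) (K L : ℝ) (hY : Y.Nonempty) (hL : 0 ≤ L)
    (hK : ((Y - Y).card : ℝ) ≤ K * Y.card) (hc : Cov Y v0 L)
    (r : F) (hr : r ∈ quotSet Y) :
    (Y.card : ℝ) ^ 3 ≤ 4 * (L ^ 4 * K ^ 4) *
      (((Y ×ˢ Y) ×ˢ (Y ×ˢ Y)).filter fun p => p.1.1 + r * p.1.2 = p.2.1 + r * p.2.2).card := by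
  have hpos : (0:ℝ) < Y.card := by exact_mod_cast hY.card_pos
  have hYY : (19/20 : ℝ) * Y.card ≤ Y.card := by linarith
  obtain ⟨x1, h1, x2, h2, x3, h3, x4, h4, hne, hre⟩ := hr
  obtain ⟨T1, Z1, s1, c1, t1, m1⟩ := hc x1 h1 Y subset_rfl hYY
  obtain ⟨T2, Z2, s2, c2, t2, m2⟩ := hc x2 h2 Y subset_rfl hYY
  obtain ⟨T3, Z3, s3, c3, t3, m3⟩ := hc x3 h3 Y subset_rfl hYY
  obtain ⟨T4, Z4, s4, c4, t4, m4⟩ := hc x4 h4 Y subset_rfl hYY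
  set Z := (Z1 ∩ Z2) ∩ (Z3 ∩ Z4) with hZ
  have cZ := inter4_big Y Z1 Z2 Z3 Z4 s1 s2 s3 s4 c1 c2 c3 c4
  have hd : x3 - x4 ≠ 0 := sub_ne_zero.mpr hne
  have hZY : Z ⊆ Y := fun z hz => by
    simp only [hZ, Finset.mem_inter] at hz
    exact s1 hz.1.1
  have hb := card_image_bound (Z ×ˢ Z)
    (fun p => (x3 - x4) * (p.1 + r * p.2))
    ((T3 - T4) + (T1 - T2)) ((Y + Y) - (Y + Y)) v0 (by
      rintro ⟨z, z'⟩ hp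
      rw [Finset.mem_product] at hp
      simp only [hZ, Finset.mem_inter] at hp
      obtain ⟨⟨-, a3, a4⟩, ⟨b1, b2⟩, b3, b4⟩ := hp
      obtain ⟨τ3, hτ3, y3, hy3, e3⟩ := m3 z a3
      obtain ⟨τ4, hτ4, y4, hy4, e4⟩ := m4 z a4
      obtain ⟨σ1, hσ1, w1, hw1, f1⟩ := m1 z' b1
      obtain ⟨σ2, hσ2, w2, hw2, f2⟩ := m2 z' b2
      refine ⟨(τ3 - τ4) + (σ1 - σ2), ?_, (y3 + w1) - (y4 + w2), ?_, ?_⟩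
      · exact Finset.add_mem_add (Finset.sub_mem_sub hτ3 hτ4) (Finset.sub_mem_sub hσ1 hσ2)
      · exact Finset.sub_mem_sub (Finset.add_mem_add hy3 hw1) (Finset.add_mem_add hy4 hw2)
      · have : (x3 - x4) * r = x1 - x2 := by
          rw [hre]; field_simp
        linear_combination e3 - e4 + f1 - f2 + z' * this)
  have hP := plu2 Y K hY hK
  have hT : (((T3 - T4) + (T1 - T2)).card : ℝ) ≤ (L * L) * (L * L) :=
    card_add_le_real _ _ _ _ (by positivity) (card_sub_le_real _ _ _ _ hL t3 t4)
      (card_sub_le_real _ _ _ _ hL t1 t2)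
  set I := (Z ×ˢ Z).image (fun p => (x3 - x4) * (p.1 + r * p.2)) with hI
  have hIc : (I.card : ℝ) ≤ (L * L * (L * L)) * (K ^ 4 * Y.card) := by
    have hb2 : (I.card : ℝ) ≤ (((T3 - T4) + (T1 - T2)).card : ℝ) *
        (((Y + Y) - (Y + Y)).card : ℝ) := by exact_mod_cast hb
    exact hb2.trans (mul_le_mul hT hP (by positivity) (by positivity))
  set E := ((Y ×ˢ Y) ×ˢ (Y ×ˢ Y)).filter fun p => p.1.1 + r * p.1.2 = p.2.1 + r * p.2.2 with hE
  -- Cauchy-Schwarz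
  have hcs : (((Z ×ˢ Z).card : ℝ)) ^ 2 ≤ I.card * E.card := by
    set f : F × F → F := (fun p => (x3 - x4) * (p.1 + r * p.2)) with hf
    have h5 := Finset.card_eq_sum_card_image f (Z ×ˢ Z)
    have h6 : ((∑ b ∈ I, (((Z ×ˢ Z).filter fun a => f a = b).card : ℝ))) ^ 2 ≤
      I.card * ∑ b ∈ I, (((Z ×ˢ Z).filter fun a => f a = b).card : ℝ) ^ 2 := sq_sum_le_card_mul_sum_sq
    have h7 : ∑ b ∈ I, (((Z ×ˢ Z).filter fun a => f a = b).card) ^ 2 ≤ E.card := by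
      have : ∀ b, (((Z ×ˢ Z).filter fun a => f a = b).card) ^ 2 =
        (((Z ×ˢ Z).filter fun a => f a = b) ×ˢ ((Z ×ˢ Z).filter fun a => f a = b)).card := by
        intro b; rw [Finset.card_product, sq]
      simp only [this]
      rw [← Finset.card_biUnion]
      · apply Finset.card_le_card
        intro p hp
        simp only [Finset.mem_biUnion, Finset.mem_product, Finset.mem_filter] at hp
        obtain ⟨b, -, ⟨⟨p1, p2⟩, p3⟩, ⟨q1, q2⟩, q3⟩ := hp
        simp only [hE, Finset.mem_filter, Finset.mem_product]
        refine ⟨⟨⟨hZY p1, hZY p2⟩, hZY q1, hZY q2⟩, ?_⟩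
        have : f p.1 = f p.2 := p3.trans q3.symm
        exact mul_left_cancel₀ hd this
      · intro b _ b' _ hbb
        rw [Function.onFun, Finset.disjoint_left]
        intro p hp hp'
        simp only [Finset.mem_product, Finset.mem_filter] at hp hp'
        exact hbb (hp.1.2.symm.trans hp'.1.2)
    rw [h5]; push_cast
    refine h6.trans ?_
    gcongr
    exact_mod_cast h7
  rw [Finset.card_product] at hcs
  push_cast at hcs
  have hsq : ((4/5 : ℝ) * Y.card) ^ 4 ≤ (Z.card : ℝ) ^ 4 := by gcongr
  have h8 : (I.card : ℝ) * E.card ≤ (L * L * (L * L)) * (K ^ 4 * Y.card) * E.card := by gcongr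
  have h10 : (0:ℝ) ≤ (Y.card : ℝ)^4 := by positivity
  have : (Y.card : ℝ) ^ 3 * Y.card ≤ (4 * (L ^ 4 * K ^ 4) * E.card) * Y.card := by nlinarith
  exact le_of_mul_le_mul_right this hpos

lemma quot_subfield [Fintype F] (Y : Finset F) (h0 : (0:F) ∉ Y) (hY : 2 ≤ Y.card)
    (h1 : ∀ r ∈ quotSet Y, r + 1 ∈ quotSet Y)
    (h2 : ∀ r ∈ quotSet Y, ∀ y ∈ Y, ∀ y' ∈ Y, (y / y') * r ∈ quotSet Y) :
    ∃ M : Subfield F, (∀ x, x ∈ M ↔ x ∈ quotSet Y) ∧ ∀ y ∈ Y, ∀ y' ∈ Y, y / y' ∈ M := by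
  obtain ⟨u, hu, w, hw, huw⟩ := Finset.one_lt_card.mp hY
  have hR0 : (0:F) ∈ quotSet Y := ⟨u, hu, u, hu, u, hu, w, hw, huw, by simp⟩
  let P : F → Prop := fun t => ∀ r ∈ quotSet Y, r + t ∈ quotSet Y
  have P0 : P 0 := fun r hr => by simpa using hr
  have P1 : P 1 := h1
  have Padd : ∀ s t, P s → P t → P (s + t) := fun s t hs ht r hr => by
    rw [← add_assoc]; exact ht _ (hs _ hr)
  have Pns : ∀ (k : ℕ) t, P t → P (k • t) := by
    intro k t ht
    induction k with
    | zero => simpa using P0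
    | succ k ih => rw [succ_nsmul]; exact Padd _ _ ih ht
  have Pneg : ∀ t, P t → P (-t) := by
    intro t ht
    have h := Pns (Fintype.card F - 1) t ht
    have hc : Fintype.card F • t = 0 := card_nsmul_eq_zero
    have hpos : 0 < Fintype.card F := Fintype.card_pos
    have : (Fintype.card F - 1) • t = -t := by
      rw [eq_neg_iff_add_eq_zero, ← succ_nsmul, Nat.sub_add_cancel hpos, hc]
    rwa [this] at h
  let Q : F → Prop := fun m => ∀ g, P g → P (m * g)
  have Q1 : Q 1 := fun g hg => by simpa using hg
  have Qmul : ∀ a b, Q a → Q b → Q (a * b) := fun a b ha hb g hg => by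
    rw [mul_assoc]; exact ha _ (hb _ hg)
  have Qpow : ∀ (k : ℕ) a, Q a → Q (a ^ k) := by
    intro k a ha
    induction k with
    | zero => simpa using Q1
    | succ k ih => rw [pow_succ]; exact Qmul _ _ ih ha
  have Q0 : Q 0 := fun g _ => by simpa using P0
  let M : Subfield F :=
    { carrier := {x | Q x}
      mul_mem' := fun {a b} ha hb => Qmul a b ha hb
      one_mem' := Q1
      add_mem' := fun {a b} ha hb g hg => by
        rw [add_mul]; exact Padd _ _ (ha g hg) (hb g hg)
      zero_mem' := Q0
      neg_mem' := fun {a} ha g hg => by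
        rw [neg_mul]; exact Pneg _ (ha g hg)
      inv_mem' := fun a ha => by
        by_cases h : a = 0
        · subst h; simpa using Q0
        · have hcard : 2 ≤ Fintype.card F := Fintype.one_lt_card
          have : a⁻¹ = a ^ (Fintype.card F - 2) := by
            have h3 := FiniteField.pow_card_sub_one_eq_one a h
            have h4 : Fintype.card F - 1 = (Fintype.card F - 2) + 1 := by omega
            rw [h4, pow_succ] at h3
            exact (eq_inv_of_mul_eq_one_left h3).symm
          show Q a⁻¹
          rw [this]
          exact Qpow _ _ ha }
  have hM : ∀ x, x ∈ M ↔ Q x := fun x => Iff.rfl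
  have hquo : ∀ y ∈ Y, ∀ y' ∈ Y, y / y' ∈ M := by
    intro y hy y' hy'
    rw [hM]
    intro g hg r hr
    have hy0 : y ≠ 0 := fun h => h0 (h ▸ hy)
    have hy0' : y' ≠ 0 := fun h => h0 (h ▸ hy')
    have : r + y / y' * g = (y / y') * ((y' / y) * r + g) := by
      field_simp
    rw [this]
    exact h2 _ (hg _ (h2 _ hr _ hy' _ hy)) _ hy _ hy'
  refine ⟨M, fun x => ⟨fun hx => ?_, fun hx => ?_⟩, hquo⟩
  · have := ((hM x).mp hx) 1 P1 0 hR0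
    simpa using this
  · obtain ⟨x1, a1, x2, a2, x3, a3, x4, a4, hne, rfl⟩ := hx
    have hu0 : u ≠ 0 := fun h => h0 (h ▸ hu)
    have : (x1 - x2) / (x3 - x4) = (x1 / u - x2 / u) / (x3 / u - x4 / u) := by
      rw [← sub_div, ← sub_div, div_div_div_cancel_right₀ hu0]
    rw [this]
    exact div_mem (sub_mem (hquo _ a1 _ hu) (hquo _ a2 _ hu))
      (sub_mem (hquo _ a3 _ hu) (hquo _ a4 _ hu))

lemma energy_sum (Y R : Finset F) :
    ∑ r ∈ R, (((Y ×ˢ Y) ×ˢ (Y ×ˢ Y)).filter fun p => p.1.1 + r * p.1.2 = p.2.1 + r * p.2.2).card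
      ≤ Y.card ^ 4 + R.card * Y.card ^ 2 := by
  set Q := (Y ×ˢ Y) ×ˢ (Y ×ˢ Y) with hQ
  have h1 : ∑ r ∈ R, (Q.filter fun p => p.1.1 + r * p.1.2 = p.2.1 + r * p.2.2).card =
      ∑ p ∈ Q, (R.filter fun r => p.1.1 + r * p.1.2 = p.2.1 + r * p.2.2).card := by
    simp only [Finset.card_filter]
    exact Finset.sum_comm
  rw [h1]
  have h2 : ∀ p ∈ Q, (R.filter fun r => p.1.1 + r * p.1.2 = p.2.1 + r * p.2.2).card ≤
      1 + R.card * (if p.1 = p.2 then 1 else 0) := by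
    intro p _
    by_cases h : p.1.2 = p.2.2
    · by_cases h' : p.1.1 = p.2.1
      · rw [if_pos (Prod.ext h' h)]
        have := Finset.card_filter_le R fun r => p.1.1 + r * p.1.2 = p.2.1 + r * p.2.2
        omega
      · rw [Finset.filter_false_of_mem]
        · simp
        · intro r _ he
          rw [h] at he
          exact h' (add_right_cancel he)
    · refine le_trans ?_ (Nat.le_add_right 1 _)
      rw [Finset.card_le_one]
      intro r hr r' hr'
      simp only [Finset.mem_filter] at hr hr'
      have : (r - r') * (p.1.2 - p.2.2) = 0 := by linear_combination hr.2 - hr'.2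
      rcases mul_eq_zero.mp this with h3 | h3
      · exact sub_eq_zero.mp h3
      · exact absurd (sub_eq_zero.mp h3) h
  refine (Finset.sum_le_sum h2).trans ?_
  rw [Finset.sum_add_distrib, ← Finset.mul_sum, ← Finset.card_filter]
  have h3 : (Q.filter fun p => p.1 = p.2).card ≤ Y.card ^ 2 := by
    rw [sq, ← Finset.card_product]
    apply Finset.card_le_card_of_injOn (fun p => p.1)
    · intro p hp
      simp only [hQ, Finset.coe_filter, Set.mem_setOf_eq, Finset.mem_product] at hp
      simp only [Finset.coe_product, Set.mem_prod, Finset.mem_coe]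
      exact hp.1.1
    · intro p hp p' hp' he
      simp only [Finset.coe_filter, Set.mem_setOf_eq] at hp hp'
      have he' : p.1 = p'.1 := he
      exact Prod.ext he' (by rw [← hp.2, ← hp'.2, he'])
  have h4 : ∑ p ∈ Q, 1 = Y.card ^ 4 := by
    rw [← Finset.card_eq_sum_ones, hQ]; simp only [Finset.card_product]; ring
  rw [h4]
  gcongr

lemma pivot [Fintype F] (Y : Finset F) (v0 : F) (K L : ℝ) (h0 : (0:F) ∉ Y) (hY : 2 ≤ Y.card) (hL : 0 ≤ L)
    (hK : ((Y - Y).card : ℝ) ≤ K * Y.card) (hc : Cov Y v0 L)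
    (b1 : 2 * L ^ 6 * K ^ 6 < Y.card) (b2 : 2 * L ^ 8 * K ^ 4 < Y.card)
    (b3 : 8 * (L ^ 4 * K ^ 4) ≤ Y.card) :
    ∃ M : Subfield F, (Nat.card M : ℝ) ≤ 8 * (L ^ 4 * K ^ 4) * Y.card ∧
      ∀ y ∈ Y, ∀ y' ∈ Y, y / y' ∈ M := by
  have hne : Y.Nonempty := Finset.card_pos.mp (by omega)
  obtain ⟨M, hM, hq⟩ := quot_subfield Y h0 hY
    (by
      intro r hr
      by_contra hcon
      obtain ⟨x1, a1, x2, a2, x3, a3, x4, a4, hne', rfl⟩ := hr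
      have := case1 Y v0 K L hne hL hK hc x1 x2 x3 x4 a1 a2 a3 a4 hne' hcon
      linarith)
    (by
      intro r hr y hy y' hy'
      by_contra hcon
      obtain ⟨x1, a1, x2, a2, x3, a3, x4, a4, hne', rfl⟩ := hr
      have := case2 Y v0 K L hne hL hK hc x1 x2 x3 x4 y y' a1 a2 a3 a4 hne' hy hy'
        (fun h => h0 (h ▸ hy')) hcon
      linarith)
  refine ⟨M, ?_, hq⟩
  set R : Finset F := Finset.univ.filter (· ∈ M) with hR
  have hcard : Nat.card M = R.card := by
    rw [hR, Nat.card_eq_fintype_card, Fintype.card_subtype]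
  rw [hcard]
  set J := L ^ 4 * K ^ 4 with hJ
  have hJ0 : 0 ≤ J := by positivity
  have hpos : (0:ℝ) < Y.card := by exact_mod_cast hne.card_pos
  have e1 : (R.card : ℝ) * (Y.card : ℝ) ^ 3 ≤ 4 * J * ((Y.card : ℝ) ^ 4 + R.card * (Y.card : ℝ) ^ 2) := by
    have := Finset.sum_le_sum (s := R) (f := fun _ => (Y.card : ℝ) ^ 3) (g := fun r => 4 * J *
      (((((Y ×ˢ Y) ×ˢ (Y ×ˢ Y)).filter fun p => p.1.1 + r * p.1.2 = p.2.1 + r * p.2.2).card : ℕ) : ℝ)) (by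
        intro r hr
        apply case3 Y v0 K L hne hL hK hc r
        rw [← hM]
        simpa [hR] using hr)
    rw [Finset.sum_const, nsmul_eq_mul, ← Finset.mul_sum] at this
    refine this.trans ?_
    gcongr
    exact_mod_cast energy_sum Y R
  have e2 : (R.card : ℝ) * (Y.card : ℝ) ^ 2 * (8 * J) ≤ (R.card : ℝ) * (Y.card : ℝ) ^ 2 * Y.card := by
    gcongr
  have e3 : (R.card : ℝ) * (Y.card : ℝ) ^ 3 ≤ (8 * J * Y.card) * (Y.card : ℝ) ^ 3 := by nlinarith
  exact le_of_mul_le_mul_right e3 (by positivity)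

/-- number of points of `A × A` other than `(a, b)` on the line of inverse slope `s` through `(a, b)` -/
def mm (A : Finset F) (a b s : F) : ℕ :=
  ((A.erase b).filter fun y => a + s * (y - b) ∈ A).card

lemma poor_count [Fintype F] (A : Finset F) (k : ℝ) :
    ((((A ×ˢ A) ×ˢ (A ×ˢ A)).filter fun p => p.2.2 ≠ p.1.2 ∧
      (mm A p.1.1 p.1.2 ((p.2.1 - p.1.1) / (p.2.2 - p.1.2)) : ℝ) < k).card : ℝ) ≤
      4 * k ^ 2 * numLines (A ×ˢ A) := by
  set Q := ((A ×ˢ A) ×ˢ (A ×ˢ A)).filter fun p => p.2.2 ≠ p.1.2 ∧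
      (mm A p.1.1 p.1.2 ((p.2.1 - p.1.1) / (p.2.2 - p.1.2)) : ℝ) < k with hQ
  let f : (F × F) × (F × F) → Set (F × F) := fun p =>
    {z : F × F | 1 * z.1 + (-((p.2.1 - p.1.1) / (p.2.2 - p.1.2))) * z.2 =
      p.1.1 - ((p.2.1 - p.1.1) / (p.2.2 - p.1.2)) * p.1.2}
  have hf1 : ∀ p, p.1 ∈ f p := by
    intro p
    show 1 * p.1.1 + _ * _ = _
    ring
  have hf2 : ∀ p, p.2.2 ≠ p.1.2 → p.2 ∈ f p := by
    intro p hp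
    show 1 * p.2.1 + _ * _ = _
    have : p.2.2 - p.1.2 ≠ 0 := sub_ne_zero.mpr hp
    field_simp
    ring
  have hmem : ∀ p, p ∈ Q ↔ (((p.1.1 ∈ A ∧ p.1.2 ∈ A) ∧ (p.2.1 ∈ A ∧ p.2.2 ∈ A)) ∧ p.2.2 ≠ p.1.2 ∧
      (mm A p.1.1 p.1.2 ((p.2.1 - p.1.1) / (p.2.2 - p.1.2)) : ℝ) < k) := by
    intro p
    simp only [hQ, Finset.mem_filter, Finset.mem_product]
  have hline : ∀ p ∈ Q, (((A ×ˢ A).filter (· ∈ f p)).card : ℝ) ≤ 2 * k := by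
    intro p hp
    rw [hmem] at hp
    obtain ⟨⟨⟨ha, hb⟩, hx, hy⟩, hne, hk⟩ := hp
    set s := (p.2.1 - p.1.1) / (p.2.2 - p.1.2) with hs
    have hd : p.2.2 - p.1.2 ≠ 0 := sub_ne_zero.mpr hne
    have hpos : 1 ≤ mm A p.1.1 p.1.2 s := by
      apply Finset.card_pos.mpr
      refine ⟨p.2.2, ?_⟩
      rw [Finset.mem_filter, Finset.mem_erase]
      refine ⟨⟨hne, hy⟩, ?_⟩
      have : p.1.1 + s * (p.2.2 - p.1.2) = p.2.1 := by
        rw [hs]; field_simp; ring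
      rwa [this]
    have hle : ((A ×ˢ A).filter (· ∈ f p)).card ≤ mm A p.1.1 p.1.2 s + 1 := by
      have h1 : (((A ×ˢ A).filter (· ∈ f p)).erase p.1).card ≤ mm A p.1.1 p.1.2 s := by
        apply Finset.card_le_card_of_injOn (fun z => z.2)
        · intro z hz
          simp only [Finset.coe_erase, Finset.coe_filter, Set.mem_sdiff, Set.mem_ofPred_eq,
            Finset.mem_product, Set.mem_singleton_iff] at hz
          obtain ⟨⟨⟨z1, z2⟩, hz3⟩, hz4⟩ := hz
          have hz5 : 1 * z.1 + (-s) * z.2 = p.1.1 - s * p.1.2 := hz3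
          have hz6 : z.1 = p.1.1 + s * (z.2 - p.1.2) := by linear_combination hz5
          simp only [Finset.coe_filter, Finset.mem_erase, Set.mem_ofPred_eq]
          refine ⟨⟨?_, z2⟩, by rw [← hz6]; exact z1⟩
          intro h
          apply hz4
          refine Prod.ext ?_ h
          rw [hz6, h]; ring
        · intro z hz z' hz' he
          simp only [Finset.coe_erase, Finset.coe_filter, Set.mem_sdiff, Set.mem_ofPred_eq,
            Finset.mem_product, Set.mem_singleton_iff] at hz hz'
          have h5 : 1 * z.1 + (-s) * z.2 = p.1.1 - s * p.1.2 := hz.1.2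
          have h6 : 1 * z'.1 + (-s) * z'.2 = p.1.1 - s * p.1.2 := hz'.1.2
          have he' : z.2 = z'.2 := he
          refine Prod.ext ?_ he'
          rw [he'] at h5
          linear_combination h5 - h6
      have := Finset.pred_card_le_card_erase (s := (A ×ˢ A).filter (· ∈ f p)) (a := p.1)
      omega
    have hle' : (((A ×ˢ A).filter (· ∈ f p)).card : ℝ) ≤ mm A p.1.1 p.1.2 s + 1 := by exact_mod_cast hle
    have hpos' : (1:ℝ) ≤ mm A p.1.1 p.1.2 s := by exact_mod_cast hpos
    linarith
  have hcount := Finset.card_eq_sum_card_image f Q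
  have hfib : ∀ l ∈ Q.image f, ((Q.filter fun p => f p = l).card : ℝ) ≤ 4 * k ^ 2 := by
    intro l hl
    obtain ⟨p0, hp0, rfl⟩ := Finset.mem_image.mp hl
    have h1 : (Q.filter fun p => f p = f p0).card ≤
        ((A ×ˢ A).filter (· ∈ f p0)).card * ((A ×ˢ A).filter (· ∈ f p0)).card := by
      rw [← Finset.card_product]
      apply Finset.card_le_card
      intro p hp
      rw [Finset.mem_filter] at hp
      obtain ⟨hp, he⟩ := hp
      rw [hmem] at hp
      simp only [Finset.mem_product, Finset.mem_filter]
      rw [← he]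
      exact ⟨⟨hp.1.1, hf1 p⟩, hp.1.2, hf2 p hp.2.1⟩
    have h2 := hline p0 hp0
    calc ((Q.filter fun p => f p = f p0).card : ℝ) ≤
        (((A ×ˢ A).filter (· ∈ f p0)).card : ℝ) * ((A ×ˢ A).filter (· ∈ f p0)).card := by exact_mod_cast h1
      _ ≤ (2 * k) * (2 * k) :=
        mul_le_mul h2 h2 (Nat.cast_nonneg _) (le_trans (Nat.cast_nonneg _) h2)
      _ = _ := by ring
  have himg : (Q.image f).card ≤ numLines (A ×ˢ A) := by
    unfold numLines
    rw [← Set.ncard_coe_finset]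
    apply Set.ncard_le_ncard _ (Set.toFinite _)
    intro l hl
    obtain ⟨p, hp, rfl⟩ := Finset.mem_image.mp (Finset.mem_coe.mp hl)
    rw [hmem] at hp
    refine ⟨⟨1, _, _, by simp, rfl⟩, ?_⟩
    apply Finset.one_lt_card.mpr
    refine ⟨p.1, ?_, p.2, ?_, ?_⟩
    · rw [Finset.mem_filter, Finset.mem_product]; exact ⟨hp.1.1, hf1 p⟩
    · rw [Finset.mem_filter, Finset.mem_product]; exact ⟨hp.1.2, hf2 p hp.2.1⟩
    · intro h; exact hp.2.1 (by rw [h])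
  have h9 : (Q.card : ℝ) = ∑ l ∈ Q.image f, ((Q.filter fun p => f p = l).card : ℝ) := by
    exact_mod_cast hcount
  rw [h9]
  refine (Finset.sum_le_card_nsmul _ _ _ hfib).trans ?_
  rw [nsmul_eq_mul, mul_comm]
  gcongr

lemma markov {α : Type*} (S : Finset α) (p : α → Prop) [DecidablePred p] (f : α → ℝ) (c B : ℝ)
    (hf : ∀ x ∈ S, 0 ≤ f x) (hp : ∀ x ∈ S, p x → c ≤ f x) (hB : ∑ x ∈ S, f x ≤ B) :
    ((S.filter p).card : ℝ) * c ≤ B := by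
  calc ((S.filter p).card : ℝ) * c = (S.filter p).card • c := by rw [nsmul_eq_mul]
    _ ≤ ∑ x ∈ S.filter p, f x := by
        apply Finset.card_nsmul_le_sum
        intro x hx
        rw [Finset.mem_filter] at hx
        exact hp x hx.1 hx.2
    _ ≤ ∑ x ∈ S, f x :=
        Finset.sum_le_sum_of_subset_of_nonneg (Finset.filter_subset _ _) (fun x hx _ => hf x hx)
    _ ≤ B := hB

lemma card_filter_prod {α β : Type*} (S : Finset α) (T : Finset β) (p : α → β → Prop)
    [∀ x y, Decidable (p x y)] :
    ((S ×ˢ T).filter fun q => p q.1 q.2).card = ∑ x ∈ S, (T.filter fun y => p x y).card := by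
  simp only [Finset.card_filter, Finset.sum_product]

lemma card_filter_prod' {α β : Type*} (S : Finset α) (T : Finset β) (p : α → β → Prop)
    [∀ x y, Decidable (p x y)] :
    ((S ×ˢ T).filter fun q => p q.1 q.2).card = ∑ y ∈ T, (S.filter fun x => p x y).card := by
  simp only [Finset.card_filter, Finset.sum_product_right]

/-- richness in terms of `V` -/
def mV (A V : Finset F) (a s : F) : ℕ := (V.filter fun v => a + s / v ∈ A).card

def rich [Fintype F] (A V : Finset F) (k : ℝ) (a : F) : Finset F :=
  Finset.univ.filter fun s => k ≤ (mV A V a s : ℝ)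

lemma rich_card [Fintype F] (A V : Finset F) (h0 : (0:F) ∉ V) (k : ℝ) (a : F) :
    ((rich A V k a).card : ℝ) * k ≤ V.card * A.card := by
  apply markov _ _ (fun s => (mV A V a s : ℝ)) _ _ (fun _ _ => by positivity) (fun _ _ h => h)
  have h1 : ∑ s : F, mV A V a s ≤ V.card * A.card := by
    unfold mV
    rw [← card_filter_prod Finset.univ V (fun s v => a + s / v ∈ A),
      card_filter_prod' Finset.univ V (fun s v => a + s / v ∈ A)]
    rw [← smul_eq_mul]
    apply Finset.sum_le_card_nsmul
    intro v hv
    have hv0 : v ≠ 0 := fun h => h0 (h ▸ hv)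
    apply Finset.card_le_card_of_injOn (fun s => a + s / v)
    · intro s hs
      simpa using hs
    · intro s _ s' _ he
      have he' : a + s / v = a + s' / v := he
      have := add_left_cancel he'
      exact (div_left_inj' hv0).mp this
  exact_mod_cast h1

/-- common dilates -/
def comm [Fintype F] (A : Finset F) (a1 v v' : F) : Finset F :=
  Finset.univ.filter fun s => s ≠ 0 ∧ a1 + s / v ∈ A ∧ a1 + s / v' ∈ A

/-- number of bad pairs -/
def bet (A V X : Finset F) (k : ℝ) (a : F) : Finset (F × F) :=
  (A ×ˢ X).filter fun q => (mV A V a ((q.1 - a) * q.2) : ℝ) < k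

lemma relation [Fintype F] (A V X : Finset F) (h0 : (0:F) ∉ V) (hX : X ⊆ V) (a1 a a' : F)
    (d g η k : ℝ) (hd : 0 < d) (hk : 0 < k)
    (hun : (((X ×ˢ X).filter fun q => ((comm A a1 q.1 q.2).card : ℝ) < d).card : ℝ) ≤ η * (X.card : ℝ) ^ 2)
    (hg : g ≤ η * (d / 4) * X.card)
    (hb : ((bet A V X k a).card : ℝ) ≤ g) (hb' : ((bet A V X k a').card : ℝ) ≤ g) :
    ∃ W : Finset F, (W.card : ℝ) * (d / 2) * k ^ 2 ≤ (V.card * A.card) ^ 2 ∧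
      (((X ×ˢ X).filter fun q => (a1 - a) * q.1 - (a1 - a') * q.2 ∉ W).card : ℝ) ≤
        3 * η * (X.card : ℝ) ^ 2 := by
  set S := rich A V k a with hS
  set S' := rich A V k a' with hS'
  let rep : F → Finset (F × F) := fun w => (S ×ˢ S').filter fun q => q.1 - q.2 = w
  set W : Finset F := Finset.univ.filter fun w => d / 2 ≤ ((rep w).card : ℝ) with hW
  have hSc := rich_card A V h0 k a
  have hSc' := rich_card A V h0 k a'
  have hWc : (W.card : ℝ) * (d / 2) ≤ S.card * S'.card := by
    apply markov _ _ (fun w => ((rep w).card : ℝ)) _ _ (fun _ _ => by positivity) (fun _ _ h => h)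
    have : ∑ w : F, (rep w).card = S.card * S'.card := by
      rw [← Finset.card_product]
      exact (Finset.card_eq_sum_card_fiberwise (f := fun q : F × F => q.1 - q.2)
        (fun _ _ => Finset.mem_coe.mpr (Finset.mem_univ _))).symm
    exact_mod_cast this.le
  have hbz : ∀ e, ((bet A V X k e).card : ℝ) ≤ g →
      ((X.filter fun z => d / 4 < ((A.filter fun x => (mV A V e ((x - e) * z) : ℝ) < k).card : ℝ)).card : ℝ)
        ≤ η * X.card := by
    intro e he
    have h1 := markov X (fun z => d / 4 < ((A.filter fun x => (mV A V e ((x - e) * z) : ℝ) < k).card : ℝ))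
      (fun z => ((A.filter fun x => (mV A V e ((x - e) * z) : ℝ) < k).card : ℝ)) (d / 4) g
      (fun _ _ => by positivity) (fun _ _ h => h.le) (by
        have h2 := card_filter_prod' A X (fun x z => (mV A V e ((x - e) * z) : ℝ) < k)
        unfold bet at he
        rw [h2] at he
        exact_mod_cast he)
    have h3 : _ * (d / 4) ≤ (η * X.card) * (d / 4) := h1.trans (hg.trans (by linarith))
    exact le_of_mul_le_mul_right h3 (by linarith)
  have hz := hbz a hb
  have hz' := hbz a' hb'
  set Z := X.filter fun z => d / 4 < ((A.filter fun x => (mV A V a ((x - a) * z) : ℝ) < k).card : ℝ) with hZ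
  set Z' := X.filter fun z => d / 4 < ((A.filter fun x => (mV A V a' ((x - a') * z) : ℝ) < k).card : ℝ) with hZ'
  set U := (X ×ˢ X).filter fun q => ((comm A a1 q.1 q.2).card : ℝ) < d with hU
  refine ⟨W, ?_, ?_⟩
  · calc (W.card : ℝ) * (d / 2) * k ^ 2 ≤ (S.card * S'.card) * k ^ 2 := by gcongr
      _ = (S.card * k) * (S'.card * k) := by ring
      _ ≤ (V.card * A.card) * (V.card * A.card) := by gcongr
      _ = _ := by ring
  · have hsub : ((X ×ˢ X).filter fun q => (a1 - a) * q.1 - (a1 - a') * q.2 ∉ W) ⊆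
        (U ∪ (Z ×ˢ X)) ∪ (X ×ˢ Z') := by
      intro q hq
      rw [Finset.mem_filter, Finset.mem_product] at hq
      obtain ⟨⟨q1, q2⟩, hq3⟩ := hq
      by_contra hcon
      simp only [Finset.mem_union, Finset.mem_product, not_or, not_and] at hcon
      obtain ⟨⟨c1, c2⟩, c3⟩ := hcon
      have d1 : d ≤ ((comm A a1 q.1 q.2).card : ℝ) := by
        by_contra h
        exact c1 (by rw [hU, Finset.mem_filter, Finset.mem_product]; exact ⟨⟨q1, q2⟩, not_le.mp h⟩)
      have d2 : ((A.filter fun x => (mV A V a ((x - a) * q.1) : ℝ) < k).card : ℝ) ≤ d / 4 := by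
        by_contra h
        exact c2 (by rw [hZ, Finset.mem_filter]; exact ⟨q1, not_le.mp h⟩) q2
      have d3 : ((A.filter fun x => (mV A V a' ((x - a') * q.2) : ℝ) < k).card : ℝ) ≤ d / 4 := by
        by_contra h
        exact c3 q1 (by rw [hZ', Finset.mem_filter]; exact ⟨q2, not_le.mp h⟩)
      have n1 : q.1 ≠ 0 := fun h => h0 (h ▸ hX q1)
      have n2 : q.2 ≠ 0 := fun h => h0 (h ▸ hX q2)
      apply hq3
      rw [hW, Finset.mem_filter]
      refine ⟨Finset.mem_univ _, ?_⟩
      have inj : ∀ z : F, z ≠ 0 → Function.Injective fun s : F => a1 + s / z := by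
        intro z hz s s' he
        have he' : a1 + s / z = a1 + s' / z := he
        exact (div_left_inj' hz).mp (add_left_cancel he')
      set Cm := comm A a1 q.1 q.2 with hC
      set C1 := Cm.filter fun s => (mV A V a ((a1 + s / q.1 - a) * q.1) : ℝ) < k with hC1
      set C2 := Cm.filter fun s => (mV A V a' ((a1 + s / q.2 - a') * q.2) : ℝ) < k with hC2
      have e1 : C1.card ≤ (A.filter fun x => (mV A V a ((x - a) * q.1) : ℝ) < k).card := by
        apply Finset.card_le_card_of_injOn (fun s => a1 + s / q.1)
        · intro s hs
          rw [hC1, Finset.mem_coe, Finset.mem_filter, hC, comm, Finset.mem_filter] at hs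
          rw [Finset.mem_coe, Finset.mem_filter]
          exact ⟨hs.1.2.2.1, hs.2⟩
        · exact (inj _ n1).injOn
      have e2 : C2.card ≤ (A.filter fun x => (mV A V a' ((x - a') * q.2) : ℝ) < k).card := by
        apply Finset.card_le_card_of_injOn (fun s => a1 + s / q.2)
        · intro s hs
          rw [hC2, Finset.mem_coe, Finset.mem_filter, hC, comm, Finset.mem_filter] at hs
          rw [Finset.mem_coe, Finset.mem_filter]
          exact ⟨hs.1.2.2.2, hs.2⟩
        · exact (inj _ n2).injOn
      have e3 : Cm.card ≤ C1.card + C2.card + (Cm \ (C1 ∪ C2)).card := by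
        have h1 := Finset.card_union_le C1 C2
        have h2 := Finset.le_card_sdiff (C1 ∪ C2) Cm
        omega
      have e4 : (Cm \ (C1 ∪ C2)).card ≤ (rep ((a1 - a) * q.1 - (a1 - a') * q.2)).card := by
        apply Finset.card_le_card_of_injOn
          (fun s => ((a1 + s / q.1 - a) * q.1, (a1 + s / q.2 - a') * q.2))
        · intro s hs
          rw [Finset.mem_coe, Finset.mem_sdiff, Finset.mem_union, not_or, hC1, hC2, Finset.mem_filter,
            Finset.mem_filter] at hs
          obtain ⟨hs1, hs2, hs3⟩ := hs
          have hs2' := not_lt.mp fun h => hs2 ⟨hs1, h⟩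
          have hs3' := not_lt.mp fun h => hs3 ⟨hs1, h⟩
          rw [Finset.mem_coe, Finset.mem_filter, Finset.mem_product, hS, hS', rich, rich,
            Finset.mem_filter, Finset.mem_filter]
          refine ⟨⟨⟨Finset.mem_univ _, hs2'⟩, Finset.mem_univ _, hs3'⟩, ?_⟩
          show (a1 + s / q.1 - a) * q.1 - (a1 + s / q.2 - a') * q.2 = _
          field_simp
          ring
        · intro s _ s' _ he
          have he' : (a1 + s / q.1 - a) * q.1 = (a1 + s' / q.1 - a) * q.1 := congrArg Prod.fst he
          have := mul_right_cancel₀ n1 he'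
          exact inj _ n1 (sub_left_injective this)
      have e1' : (C1.card : ℝ) ≤ ((A.filter fun x => (mV A V a ((x - a) * q.1) : ℝ) < k).card : ℝ) := by
        exact_mod_cast e1
      have e2' : (C2.card : ℝ) ≤ ((A.filter fun x => (mV A V a' ((x - a') * q.2) : ℝ) < k).card : ℝ) := by
        exact_mod_cast e2
      have e3' : (Cm.card : ℝ) ≤ C1.card + C2.card + (Cm \ (C1 ∪ C2)).card := by exact_mod_cast e3
      have e4' : ((Cm \ (C1 ∪ C2)).card : ℝ) ≤ ((rep ((a1 - a) * q.1 - (a1 - a') * q.2)).card : ℝ) := by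
        exact_mod_cast e4
      linarith
    have h1 := Finset.card_le_card hsub
    have h2 := Finset.card_union_le (U ∪ (Z ×ˢ X)) (X ×ˢ Z')
    have h3 := Finset.card_union_le U (Z ×ˢ X)
    rw [Finset.card_product] at h2 h3
    have h4 : (((X ×ˢ X).filter fun q => (a1 - a) * q.1 - (a1 - a') * q.2 ∉ W).card : ℝ) ≤
        U.card + Z.card * X.card + X.card * Z'.card := by
      exact_mod_cast h1.trans (h2.trans (by omega))
    have h5 : (Z.card : ℝ) * X.card ≤ (η * X.card) * X.card := by gcongr
    have h6 : (X.card : ℝ) * Z'.card ≤ X.card * (η * X.card) := by gcongr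
    nlinarith

lemma sumS [Fintype F] (A V V' : Finset F) (h0 : (0:F) ∉ V) (hV : V' ⊆ V) (a1 : F)
    (k : ℝ) :
    (A.card : ℝ) * V'.card ≤ (∑ s ∈ (rich A V k a1).erase 0,
      ((V'.filter fun v => a1 + s / v ∈ A).card : ℝ)) + V'.card + (bet A V V' k a1).card := by
  set S := (rich A V k a1).erase 0 with hS
  set P := (A ×ˢ V').filter fun q => q.1 ≠ a1 ∧ k ≤ (mV A V a1 ((q.1 - a1) * q.2) : ℝ) with hP
  have hsub : A ×ˢ V' ⊆ (P ∪ ({a1} ×ˢ V')) ∪ bet A V V' k a1 := by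
    intro q hq
    have hq' := Finset.mem_product.mp hq
    simp only [Finset.mem_union, hP, bet, Finset.mem_filter]
    by_cases h1 : q.1 = a1
    · left; right
      rw [Finset.mem_product]
      exact ⟨by simp [h1], hq'.2⟩
    · by_cases h2 : k ≤ (mV A V a1 ((q.1 - a1) * q.2) : ℝ)
      · left; left; exact ⟨hq, h1, h2⟩
      · right; exact ⟨hq, not_le.mp h2⟩
  have c1 := Finset.card_le_card hsub
  have c2 := Finset.card_union_le (P ∪ ({a1} ×ˢ V')) (bet A V V' k a1)
  have c3 := Finset.card_union_le P ({a1} ×ˢ V')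
  rw [Finset.card_product] at c1 c3
  rw [Finset.card_singleton] at c3
  have c4 : P.card ≤ ∑ s ∈ S, (V'.filter fun v => a1 + s / v ∈ A).card := by
    have hmaps : ∀ q ∈ P, (q.1 - a1) * q.2 ∈ S := by
      intro q hq
      rw [hP, Finset.mem_filter, Finset.mem_product] at hq
      rw [hS, Finset.mem_erase, rich, Finset.mem_filter]
      refine ⟨mul_ne_zero (sub_ne_zero.mpr hq.2.1) (fun h => h0 (h ▸ hV hq.1.2)), Finset.mem_univ _, hq.2.2⟩
    rw [Finset.card_eq_sum_card_fiberwise (f := fun q : F × F => (q.1 - a1) * q.2) (t := S)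
      (fun q hq => Finset.mem_coe.mpr (hmaps q (Finset.mem_coe.mp hq)))]
    apply Finset.sum_le_sum
    intro s _
    apply Finset.card_le_card_of_injOn (fun q => q.2)
    · intro q hq
      rw [Finset.mem_coe, Finset.mem_filter, hP, Finset.mem_filter, Finset.mem_product] at hq
      rw [Finset.mem_coe, Finset.mem_filter]
      refine ⟨hq.1.1.2, ?_⟩
      have hq0 : q.2 ≠ 0 := fun h => h0 (h ▸ hV hq.1.1.2)
      have : a1 + s / q.2 = q.1 := by
        rw [← hq.2]; field_simp; ring
      show a1 + s / q.2 ∈ A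
      rw [this]; exact hq.1.1.1
    · intro q hq q' hq' he
      rw [Finset.mem_coe, Finset.mem_filter, hP, Finset.mem_filter, Finset.mem_product] at hq hq'
      have he' : q.2 = q'.2 := he
      have hq0 : q.2 ≠ 0 := fun h => h0 (h ▸ hV hq.1.1.2)
      have h3 : (q.1 - a1) * q.2 = (q'.1 - a1) * q.2 := by
        have := hq.2.trans hq'.2.symm
        rwa [← he'] at this
      exact Prod.ext (sub_left_injective (mul_right_cancel₀ hq0 h3)) he'
  have c5 : A.card * V'.card ≤ (∑ s ∈ S, (V'.filter fun v => a1 + s / v ∈ A).card) + V'.card +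
      (bet A V V' k a1).card := by omega
  exact_mod_cast c5

lemma findX [Fintype F] (A V' : Finset F) (a1 : F) (n M η d : ℝ) (hn : 0 < n) (hM : 0 < M) (hη : 0 < η)
    (hV : (V'.card : ℝ) ≤ n) (S : Finset F) (hS0 : (0:F) ∉ S) (hS : (S.card : ℝ) ≤ n * M)
    (hsum : n ^ 2 / 2 ≤ ∑ s ∈ S, ((V'.filter fun v => a1 + s / v ∈ A).card : ℝ))
    (hd : d = η / 32 * (n / M)) :
    ∃ X ⊆ V', n / (4 * M) ≤ X.card ∧
    (((X ×ˢ X).filter fun q => ((comm A a1 q.1 q.2).card : ℝ) < d).card : ℝ) ≤ η * (X.card : ℝ) ^ 2 := by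
  let Vs : F → Finset F := fun s => V'.filter fun v => a1 + s / v ∈ A
  let un : F → Finset (F × F) := fun s =>
    (Vs s ×ˢ Vs s).filter fun q => ((comm A a1 q.1 q.2).card : ℝ) < d
  have hsum : n ^ 2 / 2 ≤ ∑ s ∈ S, ((Vs s).card : ℝ) := hsum
  have hd0 : 0 < d := by rw [hd]; positivity
  by_contra hcon
  push Not at hcon
  set S1 := S.filter fun s => n / (4 * M) ≤ ((Vs s).card : ℝ) with hS1
  have key : ∀ s ∈ S1, η * (n / (4 * M)) * ((Vs s).card : ℝ) ≤ ((un s).card : ℝ) := by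
    intro s hs
    rw [hS1, Finset.mem_filter] at hs
    have h1 := hcon (Vs s) (Finset.filter_subset _ _) hs.2
    refine le_trans ?_ h1.le
    rw [sq, ← mul_assoc]
    gcongr
    exact hs.2
  have hsplit : n ^ 2 / 4 ≤ ∑ s ∈ S1, ((Vs s).card : ℝ) := by
    have h1 := Finset.sum_filter_add_sum_filter_not S (fun s => n / (4 * M) ≤ ((Vs s).card : ℝ))
      (fun s => ((Vs s).card : ℝ))
    have h2 : ∑ s ∈ S.filter (fun s => ¬ n / (4 * M) ≤ ((Vs s).card : ℝ)), ((Vs s).card : ℝ) ≤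
        (n * M) * (n / (4 * M)) := by
      refine (Finset.sum_le_card_nsmul _ _ (n / (4 * M)) ?_).trans ?_
      · intro s hs
        rw [Finset.mem_filter] at hs
        exact (not_le.mp hs.2).le
      · rw [nsmul_eq_mul]
        gcongr
        refine le_trans ?_ hS
        exact_mod_cast Finset.card_filter_le _ _
    have h3 : (n * M) * (n / (4 * M)) = n ^ 2 / 4 := by field_simp
    rw [h3] at h2
    linarith
  have hun : ∑ s ∈ S1, ((un s).card : ℝ) ≤ n ^ 2 * d := by
    set Q := (V' ×ˢ V').filter fun q => ((comm A a1 q.1 q.2).card : ℝ) < d with hQ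
    have h1 : ∑ s ∈ S1, (un s).card ≤ ∑ q ∈ Q, (comm A a1 q.1 q.2).card := by
      have h2 : ∀ s ∈ S1, (un s).card ≤ (Q.filter fun q => s ∈ comm A a1 q.1 q.2).card := by
        intro s hs
        apply Finset.card_le_card
        intro q hq
        rw [hS1, Finset.mem_filter] at hs
        simp only [un, Vs, Finset.mem_filter, Finset.mem_product] at hq
        rw [Finset.mem_filter, hQ, Finset.mem_filter, Finset.mem_product]
        refine ⟨⟨⟨hq.1.1.1, hq.1.2.1⟩, hq.2⟩, ?_⟩
        rw [comm, Finset.mem_filter]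
        exact ⟨Finset.mem_univ _, fun h => hS0 (h ▸ hs.1), hq.1.1.2, hq.1.2.2⟩
      refine (Finset.sum_le_sum h2).trans ?_
      rw [← card_filter_prod S1 Q (fun s q => s ∈ comm A a1 q.1 q.2),
        card_filter_prod' S1 Q (fun s q => s ∈ comm A a1 q.1 q.2)]
      apply Finset.sum_le_sum
      intro q _
      apply Finset.card_le_card
      intro s hs
      exact (Finset.mem_filter.mp hs).2
    have h3 : ∑ q ∈ Q, ((comm A a1 q.1 q.2).card : ℝ) ≤ Q.card • d := by
      apply Finset.sum_le_card_nsmul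
      intro q hq
      rw [hQ, Finset.mem_filter] at hq
      exact hq.2.le
    have h4 : (Q.card : ℝ) ≤ n ^ 2 := by
      have : Q.card ≤ V'.card * V'.card := by
        rw [← Finset.card_product]; exact Finset.card_filter_le _ _
      calc (Q.card : ℝ) ≤ V'.card * V'.card := by exact_mod_cast this
        _ ≤ n * n := by gcongr
        _ = _ := by ring
    calc ∑ s ∈ S1, ((un s).card : ℝ) ≤ ∑ q ∈ Q, ((comm A a1 q.1 q.2).card : ℝ) := by exact_mod_cast h1
      _ ≤ Q.card • d := h3
      _ ≤ n ^ 2 * d := by rw [nsmul_eq_mul]; gcongr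
  have hlow : η * (n / (4 * M)) * (n ^ 2 / 4) ≤ ∑ s ∈ S1, ((un s).card : ℝ) := by
    refine le_trans ?_ (Finset.sum_le_sum key)
    rw [← Finset.mul_sum]
    gcongr
  have h5 : η * (n / (4 * M)) * (n ^ 2 / 4) = 2 * (n ^ 2 * d) := by
    rw [hd]; field_simp; ring
  have h6 : 0 < n ^ 2 * d := by positivity
  linarith

lemma reference (X W : Finset F) (η L : ℝ) (hX : X.Nonempty)
    (hW : (W.card : ℝ) ≤ L * X.card)
    (hbad : (((X ×ˢ X).filter fun q => q.1 - q.2 ∉ W).card : ℝ) ≤ 3 * η * (X.card : ℝ) ^ 2) :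
    ∃ Y ⊆ X, (1 - 12 * η) * X.card ≤ Y.card ∧ ((Y - Y).card : ℝ) ≤ 2 * L ^ 2 * X.card := by
  have hN : (0:ℝ) < X.card := by exact_mod_cast hX.card_pos
  set N : ℝ := (X.card : ℝ) with hNd
  let b : F → Finset F := fun z => X.filter fun z' => z - z' ∉ W
  set Y := X.filter fun z => ((b z).card : ℝ) ≤ N / 4 with hY
  refine ⟨Y, Finset.filter_subset _ _, ?_, ?_⟩
  · have h1 := markov X (fun z => ¬ ((b z).card : ℝ) ≤ N / 4) (fun z => ((b z).card : ℝ)) (N / 4)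
      (3 * η * N ^ 2) (fun _ _ => by positivity) (fun _ _ h => (not_le.mp h).le) (by
        have h2 := card_filter_prod X X (fun z z' => z - z' ∉ W)
        rw [h2] at hbad
        exact_mod_cast hbad)
    have h3 := Finset.card_filter_add_card_filter_not (s := X) (fun z => ((b z).card : ℝ) ≤ N / 4)
    have h3' : (Y.card : ℝ) + ((X.filter fun z => ¬ ((b z).card : ℝ) ≤ N / 4).card : ℝ) = N := by
      rw [hNd]; exact_mod_cast h3
    have h4 : ((X.filter fun z => ¬ ((b z).card : ℝ) ≤ N / 4).card : ℝ) * (N / 4) ≤ (12 * η * N) * (N / 4) :=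
      h1.trans (by nlinarith)
    have h5 := le_of_mul_le_mul_right h4 (by linarith)
    linarith
  · let rep : F → Finset (F × F) := fun w => (W ×ˢ W).filter fun q => q.1 - q.2 = w
    have h1 := markov (Y - Y) (fun _ => True) (fun w => ((rep w).card : ℝ)) (N / 2) ((W.card : ℝ) ^ 2)
      (fun _ _ => by positivity) (by
        intro w hw _
        obtain ⟨y, hy, y', hy', rfl⟩ := Finset.mem_sub.mp hw
        rw [hY, Finset.mem_filter] at hy hy'
        have e1 : (X \ (b y ∪ b y')).card ≤ (rep (y - y')).card := by
          apply Finset.card_le_card_of_injOn (fun z => (y - z, y' - z))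
          · intro z hz
            simp only [Finset.mem_coe, Finset.mem_sdiff, Finset.mem_union, b, Finset.mem_filter, not_or,
              not_and, not_not] at hz
            simp only [rep, Finset.mem_coe, Finset.mem_filter, Finset.mem_product]
            exact ⟨⟨hz.2.1 hz.1, hz.2.2 hz.1⟩, by ring⟩
          · intro z _ z' _ he
            have he' : y - z = y - z' := congrArg Prod.fst he
            exact sub_right_injective he'
        have e2 : X.card ≤ (b y).card + (b y').card + (X \ (b y ∪ b y')).card := by
          have h1 := Finset.card_union_le (b y) (b y')
          have h2 := Finset.le_card_sdiff (b y ∪ b y') X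
          omega
        have e1' : ((X \ (b y ∪ b y')).card : ℝ) ≤ ((rep (y - y')).card : ℝ) := by exact_mod_cast e1
        have e2' : N ≤ (b y).card + (b y').card + ((X \ (b y ∪ b y')).card : ℝ) := by
          rw [hNd]; exact_mod_cast e2
        linarith [hy.2, hy'.2]) (by
        have : ∑ w ∈ Y - Y, (rep w).card ≤ W.card ^ 2 := by
          rw [sq, ← Finset.card_product, ← Finset.card_biUnion]
          · apply Finset.card_le_card
            intro q hq
            obtain ⟨w, -, hw⟩ := Finset.mem_biUnion.mp hq
            exact (Finset.mem_filter.mp hw).1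
          · intro w _ w' _ hww
            rw [Function.onFun, Finset.disjoint_left]
            intro q hq hq'
            exact hww ((Finset.mem_filter.mp hq).2.symm.trans (Finset.mem_filter.mp hq').2)
        exact_mod_cast this)
    rw [Finset.filter_true_of_mem (fun _ _ => trivial)] at h1
    have h2 : (W.card : ℝ) ^ 2 ≤ (L * N) ^ 2 := by gcongr
    have h3 : ((Y - Y).card : ℝ) * (N / 2) ≤ (2 * L ^ 2 * N) * (N / 2) := h1.trans (h2.trans (by nlinarith))
    exact le_of_mul_le_mul_right h3 (by linarith)

lemma badcount (A V X : Finset F) (k g B : ℝ)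
    (h : ∀ z ∈ X, (((A ×ˢ A).filter fun q => (mV A V q.1 ((q.2 - q.1) * z) : ℝ) < k).card : ℝ) ≤ B) :
    ((A.filter fun a => g < ((bet A V X k a).card : ℝ)).card : ℝ) * g ≤ X.card * B := by
  apply markov A _ (fun a => ((bet A V X k a).card : ℝ)) _ _ (fun _ _ => by positivity)
    (fun _ _ h => h.le)
  have h1 : ∑ a ∈ A, (bet A V X k a).card =
      ∑ z ∈ X, ((A ×ˢ A).filter fun q => (mV A V q.1 ((q.2 - q.1) * z) : ℝ) < k).card := by
    have e1 : ∀ a ∈ A, (bet A V X k a).card =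
        ∑ z ∈ X, (A.filter fun x => (mV A V a ((x - a) * z) : ℝ) < k).card := fun a _ =>
      card_filter_prod' A X (fun x z => (mV A V a ((x - a) * z) : ℝ) < k)
    rw [Finset.sum_congr rfl e1, Finset.sum_comm]
    apply Finset.sum_congr rfl
    intro z _
    exact (card_filter_prod A A (fun a x => (mV A V a ((x - a) * z) : ℝ) < k)).symm
  calc ∑ a ∈ A, ((bet A V X k a).card : ℝ) =
      ∑ z ∈ X, (((A ×ˢ A).filter fun q => (mV A V q.1 ((q.2 - q.1) * z) : ℝ) < k).card : ℝ) := by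
        exact_mod_cast h1
    _ ≤ X.card • B := Finset.sum_le_card_nsmul _ _ _ h
    _ = _ := by rw [nsmul_eq_mul]

lemma card_scale (W : Finset F) (c : F) : (W.image fun w => c * w).card ≤ W.card := Finset.card_image_le

set_option maxHeartbeats 1000000 in
lemma fromX [Fintype F] (A V X : Finset F) (h0 : (0:F) ∉ V) (hX : X ⊆ V) (a1 : F)
    (n t η δ d : ℝ) (hnA : (A.card : ℝ) = n) (hn : 100 ≤ n) (hVn : (V.card : ℝ) ≤ n) (ht : 1 ≤ t)
    (hη : η = 1 / 2000) (hδ : δ = 1 / 64000) (hd : d = δ * (n / t ^ 2))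
    (hN : n / (4 * t ^ 2) ≤ X.card)
    (hun : (((X ×ˢ X).filter fun q => ((comm A a1 q.1 q.2).card : ℝ) < d).card : ℝ) ≤ η * (X.card : ℝ) ^ 2)
    (hB2 : ∀ z ∈ X, (((A ×ˢ A).filter fun q => (mV A V q.1 ((q.2 - q.1) * z) : ℝ) < n / t ^ 3).card : ℝ)
      ≤ η * δ ^ 2 / 16 * n ^ 2 / t ^ 2)
    (hB1 : ∀ z ∈ X, (((A ×ˢ A).filter fun q => (mV A V q.1 ((q.2 - q.1) * z) : ℝ) < n / t ^ 4).card : ℝ)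
      ≤ η * δ ^ 2 / 16 * n ^ 2 / t ^ 4) :
    ∃ Y ⊆ X, ∃ v0 ∈ X, (X.card : ℝ) / 2 ≤ Y.card ∧
      ((Y - Y).card : ℝ) ≤ 4 * (8 / δ * t ^ 10) ^ 2 * Y.card ∧
      ∀ v ∈ Y, ∃ W : Finset F, (W.card : ℝ) ≤ 2 * (8 / δ * t ^ 12) * Y.card ∧
        (((Y ×ˢ Y).filter fun p => v * p.1 - v0 * p.2 ∉ W).card : ℝ) ≤ (Y.card : ℝ) ^ 2 / 100 := by
  have ht0 : 0 < t := by linarith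
  have hn0 : 0 < n := by linarith
  have hη0 : 0 < η := by rw [hη]; norm_num
  have hδ0 : 0 < δ := by rw [hδ]; norm_num
  have hd0 : 0 < d := by rw [hd]; positivity
  set N : ℝ := (X.card : ℝ) with hNd
  have hN0 : 0 < N := lt_of_lt_of_le (by positivity) hN
  have hnN : n ≤ 4 * t ^ 2 * N := by
    rw [div_le_iff₀ (by positivity)] at hN; linarith
  have hXne : X.Nonempty := Finset.card_pos.mp (by rw [hNd] at hN0; exact_mod_cast hN0)
  set g : ℝ := η * (d / 4) * N with hg
  have hg0 : 0 < g := by positivity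
  have hW : ∀ (k τ : ℝ) (W : Finset F), 0 < τ → k = n / τ →
      (W.card : ℝ) * (d / 2) * k ^ 2 ≤ (V.card * A.card) ^ 2 →
      (W.card : ℝ) ≤ 8 / δ * (t ^ 4 * τ ^ 2) * N := by
    intro k τ W hτ hk h
    have h1 : ((V.card : ℝ) * A.card) ^ 2 ≤ (n * n) ^ 2 := by
      rw [hnA]; gcongr
    have h2 : (W.card : ℝ) * (d / 2) * k ^ 2 ≤ (n * n) ^ 2 := h.trans h1
    have e : (W.card : ℝ) * (d / 2) * k ^ 2 = W.card * (δ * n ^ 3 / (2 * t ^ 2 * τ ^ 2)) := by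
      rw [hd, hk]; field_simp
    rw [e] at h2
    have h3 : (n * n) ^ 2 ≤ (8 / δ * (t ^ 4 * τ ^ 2) * N) * (δ * n ^ 3 / (2 * t ^ 2 * τ ^ 2)) := by
      have : (8 / δ * (t ^ 4 * τ ^ 2) * N) * (δ * n ^ 3 / (2 * t ^ 2 * τ ^ 2)) = n ^ 3 * (4 * t ^ 2 * N) := by
        field_simp; ring
      rw [this]
      have e2 : (n * n) ^ 2 = n ^ 3 * n := by ring
      rw [e2]; gcongr
    exact le_of_mul_le_mul_right (h2.trans h3) (by positivity)
  -- good points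
  have bad2 := badcount A V X (n / t ^ 3) g _ hB2
  have bad1 := badcount A V X (n / t ^ 4) g _ hB1
  have bad2' : ((A.filter fun a => g < ((bet A V X (n / t ^ 3) a).card : ℝ)).card : ℝ) ≤ δ / 4 * n := by
    refine le_of_mul_le_mul_right (bad2.trans (le_of_eq ?_)) hg0
    rw [hg, hd]; field_simp; ring
  have bad1' : ((A.filter fun a => g < ((bet A V X (n / t ^ 4) a).card : ℝ)).card : ℝ) ≤ d / 4 := by
    refine le_of_mul_le_mul_right (bad1.trans (le_of_eq ?_)) hg0
    rw [hg, hd, ← hNd]; field_simp; ring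
  -- reference point
  obtain ⟨a2, ha2, hne, hgood⟩ : ∃ a2 ∈ A, a2 ≠ a1 ∧ ((bet A V X (n / t ^ 3) a2).card : ℝ) ≤ g := by
    by_contra hcon
    push Not at hcon
    have hsub : A ⊆ insert a1 (A.filter fun a => g < ((bet A V X (n / t ^ 3) a).card : ℝ)) := by
      intro a ha
      by_cases h : a = a1
      · rw [h]; exact Finset.mem_insert_self _ _
      · exact Finset.mem_insert_of_mem (Finset.mem_filter.mpr ⟨ha, hcon a ha h⟩)
    have h1 := (Finset.card_le_card hsub).trans (Finset.card_insert_le _ _)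
    have h2 : (A.card : ℝ) ≤ ((A.filter fun a => g < ((bet A V X (n / t ^ 3) a).card : ℝ)).card : ℝ) + 1 := by
      exact_mod_cast h1
    rw [hnA] at h2
    rw [hδ] at bad2'
    linarith
  obtain ⟨W0, hW0, hW0b⟩ := relation A V X h0 hX a1 a2 a2 d g η (n / t ^ 3) hd0 (by positivity) hun le_rfl
    hgood hgood
  have hW0c := hW _ (t ^ 3) W0 (by positivity) rfl hW0
  have hne' : a1 - a2 ≠ 0 := sub_ne_zero.mpr hne.symm
  obtain ⟨Xr, hXr, hXrc, hXrd⟩ := reference X (W0.image fun w => (a1 - a2)⁻¹ * w) η (8 / δ * t ^ 10) hXne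
    (by
      have : ((W0.image fun w => (a1 - a2)⁻¹ * w).card : ℝ) ≤ W0.card := by exact_mod_cast card_scale W0 _
      refine this.trans (hW0c.trans (le_of_eq ?_))
      rw [← hNd]; ring)
    (by
      refine le_trans ?_ hW0b
      norm_cast
      apply Finset.card_le_card
      intro q hq
      rw [Finset.mem_filter] at hq ⊢
      refine ⟨hq.1, fun h => hq.2 ?_⟩
      refine Finset.mem_image.mpr ⟨_, h, ?_⟩
      field_simp)
  -- slopes
  have slope : ∀ v1 ∈ X, ∀ v2 ∈ X, d ≤ ((comm A a1 v1 v2).card : ℝ) → ∃ W : Finset F,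
      (W.card : ℝ) ≤ 8 / δ * t ^ 12 * N ∧
      (((X ×ˢ X).filter fun p => v2 * p.1 - v1 * p.2 ∉ W).card : ℝ) ≤ 3 * η * N ^ 2 := by
    intro v1 hv1 v2 hv2 hpop
    have n1 : v1 ≠ 0 := fun h => h0 (h ▸ hX hv1)
    have n2 : v2 ≠ 0 := fun h => h0 (h ▸ hX hv2)
    have inj : ∀ z : F, z ≠ 0 → Function.Injective fun s : F => a1 + s / z := by
      intro z hz s s' he
      have he' : a1 + s / z = a1 + s' / z := he
      exact (div_left_inj' hz).mp (add_left_cancel he')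
    obtain ⟨s, hs, g1, g2⟩ : ∃ s ∈ comm A a1 v1 v2,
        ((bet A V X (n / t ^ 4) (a1 + s / v1)).card : ℝ) ≤ g ∧
        ((bet A V X (n / t ^ 4) (a1 + s / v2)).card : ℝ) ≤ g := by
      by_contra hcon
      push Not at hcon
      set Cm := comm A a1 v1 v2 with hC
      set C1 := Cm.filter fun s => g < ((bet A V X (n / t ^ 4) (a1 + s / v1)).card : ℝ) with hC1
      set C2 := Cm.filter fun s => g < ((bet A V X (n / t ^ 4) (a1 + s / v2)).card : ℝ) with hC2
      have hsub : Cm ⊆ C1 ∪ C2 := by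
        intro s hs
        rw [Finset.mem_union, hC1, hC2, Finset.mem_filter, Finset.mem_filter]
        by_cases h : ((bet A V X (n / t ^ 4) (a1 + s / v1)).card : ℝ) ≤ g
        · right; exact ⟨hs, hcon s hs h⟩
        · left; exact ⟨hs, not_le.mp h⟩
      have e0 := (Finset.card_le_card hsub).trans (Finset.card_union_le _ _)
      have e1 : C1.card ≤ (A.filter fun a => g < ((bet A V X (n / t ^ 4) a).card : ℝ)).card := by
        apply Finset.card_le_card_of_injOn (fun s => a1 + s / v1)
        · intro s hs
          rw [hC1, Finset.mem_coe, Finset.mem_filter, hC, comm, Finset.mem_filter] at hs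
          rw [Finset.mem_coe, Finset.mem_filter]
          exact ⟨hs.1.2.2.1, hs.2⟩
        · exact (inj _ n1).injOn
      have e2 : C2.card ≤ (A.filter fun a => g < ((bet A V X (n / t ^ 4) a).card : ℝ)).card := by
        apply Finset.card_le_card_of_injOn (fun s => a1 + s / v2)
        · intro s hs
          rw [hC2, Finset.mem_coe, Finset.mem_filter, hC, comm, Finset.mem_filter] at hs
          rw [Finset.mem_coe, Finset.mem_filter]
          exact ⟨hs.1.2.2.2, hs.2⟩
        · exact (inj _ n2).injOn
      have e3 : (Cm.card : ℝ) ≤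
          2 * ((A.filter fun a => g < ((bet A V X (n / t ^ 4) a).card : ℝ)).card : ℝ) := by
        exact_mod_cast (show Cm.card ≤
          2 * (A.filter fun a => g < ((bet A V X (n / t ^ 4) a).card : ℝ)).card by omega)
      linarith
    obtain ⟨W, hWc, hWb⟩ := relation A V X h0 hX a1 (a1 + s / v1) (a1 + s / v2) d g η (n / t ^ 4) hd0
      (by positivity) hun le_rfl g1 g2
    have hWc' := hW _ (t ^ 4) W (by positivity) rfl hWc
    rw [comm, Finset.mem_filter] at hs
    have hs0 : s ≠ 0 := hs.2.1
    refine ⟨W.image fun w => (-(v1 * v2) / s) * w, ?_, ?_⟩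
    · have : ((W.image fun w => (-(v1 * v2) / s) * w).card : ℝ) ≤ W.card := by exact_mod_cast card_scale W _
      refine this.trans (hWc'.trans (le_of_eq ?_))
      ring
    · refine le_trans ?_ hWb
      norm_cast
      apply Finset.card_le_card
      intro q hq
      rw [Finset.mem_filter] at hq ⊢
      refine ⟨hq.1, fun h => hq.2 ?_⟩
      refine Finset.mem_image.mpr ⟨_, h, ?_⟩
      field_simp
      ring
  -- choose v0
  obtain ⟨v0, hv0, hv0c⟩ : ∃ v0 ∈ X, ((X.filter fun v => ((comm A a1 v0 v).card : ℝ) < d).card : ℝ) ≤ η * N := by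
    by_contra hcon
    push Not at hcon
    have h1 : X.card • (η * N) < ∑ v0 ∈ X, ((X.filter fun v => ((comm A a1 v0 v).card : ℝ) < d).card : ℝ) := by
      rw [← Finset.sum_const]
      exact Finset.sum_lt_sum_of_nonempty hXne hcon
    have h2 := card_filter_prod X X (fun v0 v => ((comm A a1 v0 v).card : ℝ) < d)
    rw [h2] at hun
    push_cast at hun
    rw [nsmul_eq_mul, ← hNd] at h1
    nlinarith
  set Pp := X.filter fun v => d ≤ ((comm A a1 v0 v).card : ℝ) with hPp
  have hPc : (1 - η) * N ≤ Pp.card := by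
    have h3 := Finset.card_filter_add_card_filter_not (s := X) (fun v => ((comm A a1 v0 v).card : ℝ) < d)
    simp only [not_lt] at h3
    have h4 : ((X.filter fun v => ((comm A a1 v0 v).card : ℝ) < d).card : ℝ) + Pp.card = N := by
      rw [hNd]; exact_mod_cast h3
    linarith
  have hYc := inter_big X Xr Pp _ _ hXr (Finset.filter_subset _ _) hXrc hPc
  set Y := Xr ∩ Pp with hY
  have hYX : Y ⊆ X := Finset.inter_subset_left.trans hXr
  have hYh : N / 2 ≤ Y.card := by
    refine le_trans ?_ hYc
    rw [hη, ← hNd]; linarith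
  refine ⟨Y, hYX, v0, hv0, hYh, ?_, ?_⟩
  · have h1 : ((Y - Y).card : ℝ) ≤ (Xr - Xr).card := by
      exact_mod_cast Finset.card_le_card
        (Finset.sub_subset_sub Finset.inter_subset_left Finset.inter_subset_left)
    refine h1.trans (hXrd.trans ?_)
    rw [← hNd]
    have : 2 * (8 / δ * t ^ 10) ^ 2 * N = 4 * (8 / δ * t ^ 10) ^ 2 * (N / 2) := by ring
    rw [this]
    gcongr
  · intro v hv
    have hv' := (Finset.mem_filter.mp (Finset.mem_inter.mp hv).2)
    obtain ⟨W, hWc, hWb⟩ := slope v0 hv0 v hv'.1 hv'.2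
    refine ⟨W, ?_, ?_⟩
    · refine hWc.trans ?_
      have : 8 / δ * t ^ 12 * N = 2 * (8 / δ * t ^ 12) * (N / 2) := by ring
      rw [this]; gcongr
    · have h1 : (((Y ×ˢ Y).filter fun p => v * p.1 - v0 * p.2 ∉ W).card : ℝ) ≤
          (((X ×ˢ X).filter fun p => v * p.1 - v0 * p.2 ∉ W).card : ℝ) := by
        exact_mod_cast Finset.card_le_card
          (Finset.filter_subset_filter _ (Finset.product_subset_product hYX hYX))
      refine h1.trans (hWb.trans ?_)
      rw [hη]
      have : (N / 2) ^ 2 ≤ (Y.card : ℝ) ^ 2 := by gcongr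
      nlinarith

lemma sum_bet (A V X : Finset F) (k : ℝ) :
    ∑ a ∈ A, (bet A V X k a).card =
      ∑ z ∈ X, ((A ×ˢ A).filter fun q => (mV A V q.1 ((q.2 - q.1) * z) : ℝ) < k).card := by
  have e1 : ∀ a ∈ A, (bet A V X k a).card =
      ∑ z ∈ X, (A.filter fun x => (mV A V a ((x - a) * z) : ℝ) < k).card := fun a _ =>
    card_filter_prod' A X (fun x z => (mV A V a ((x - a) * z) : ℝ) < k)
  rw [Finset.sum_congr rfl e1, Finset.sum_comm]
  apply Finset.sum_congr rfl
  intro z _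
  exact (card_filter_prod A A (fun a x => (mV A V a ((x - a) * z) : ℝ) < k)).symm

/-- total number of poor triples -/
def poor (A V : Finset F) (k : ℝ) : ℕ :=
  (((A ×ˢ A) ×ˢ V).filter fun p => (mV A V p.1.1 ((p.1.2 - p.1.1) * p.2) : ℝ) < k).card

lemma fromV [Fintype F] (A V : Finset F) (h0 : (0:F) ∉ V)
    (n t η δ μ : ℝ) (hnA : (A.card : ℝ) = n) (hn : 100 ≤ n) (hVn : (V.card : ℝ) + 1 = n) (ht : 1 ≤ t)
    (hη : η = 1 / 2000) (hδ : δ = 1 / 64000) (hμ : μ = η * δ ^ 2 / 16 / 200)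
    (H0 : (poor A V (n / t ^ 2) : ℝ) ≤ μ * n ^ 3)
    (H2 : t ^ 2 * (poor A V (n / t ^ 3) : ℝ) ≤ μ * n ^ 3)
    (H1 : t ^ 4 * (poor A V (n / t ^ 4) : ℝ) ≤ μ * n ^ 3) :
    ∃ Y ⊆ V, ∃ v0 ∈ V, n / (8 * t ^ 2) ≤ Y.card ∧
      ((Y - Y).card : ℝ) ≤ 4 * (8 / δ * t ^ 10) ^ 2 * Y.card ∧
      ∀ v ∈ Y, ∃ W : Finset F, (W.card : ℝ) ≤ 2 * (8 / δ * t ^ 12) * Y.card ∧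
        (((Y ×ˢ Y).filter fun p => v * p.1 - v0 * p.2 ∉ W).card : ℝ) ≤ (Y.card : ℝ) ^ 2 / 100 := by
  have ht0 : 0 < t := by linarith
  have hn0 : 0 < n := by linarith
  have hη0 : 0 < η := by rw [hη]; norm_num
  have hδ0 : 0 < δ := by rw [hδ]; norm_num
  set ρ := η * δ ^ 2 / 16 with hρ
  have hρ0 : 0 < ρ := by positivity
  have hμ0 : 0 < μ := by rw [hμ]; positivity
  have hμ1 : μ ≤ 1 / 100 := by rw [hμ, hρ, hη, hδ]; norm_num
  let gg : ℝ → F → ℕ := fun k z =>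
    ((A ×ˢ A).filter fun q => (mV A V q.1 ((q.2 - q.1) * z) : ℝ) < k).card
  have hpoor : ∀ k, (poor A V k : ℝ) = ∑ z ∈ V, (gg k z : ℝ) := by
    intro k
    have := card_filter_prod' (A ×ˢ A) V (fun q z => (mV A V q.1 ((q.2 - q.1) * z) : ℝ) < k)
    unfold poor
    exact_mod_cast this
  let f : F → ℝ := fun z => t ^ 2 * (gg (n / t ^ 3) z : ℝ) + t ^ 4 * (gg (n / t ^ 4) z : ℝ)
  set V' := V.filter fun z => f z ≤ ρ * n ^ 2 with hV'
  have hV'V : V' ⊆ V := Finset.filter_subset _ _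
  have hf0 : ∀ z, 0 ≤ f z := fun z => by positivity
  have hV'c : n - 1 - n / 100 ≤ (V'.card : ℝ) := by
    have h1 := markov V (fun z => ¬ f z ≤ ρ * n ^ 2) f (ρ * n ^ 2) (2 * (μ * n ^ 3)) (fun z _ => hf0 z)
      (fun _ _ h => (not_le.mp h).le) (by
        show ∑ z ∈ V, (t ^ 2 * (gg (n / t ^ 3) z : ℝ) + t ^ 4 * (gg (n / t ^ 4) z : ℝ)) ≤ _
        rw [Finset.sum_add_distrib, ← Finset.mul_sum, ← Finset.mul_sum, ← hpoor, ← hpoor]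
        linarith)
    have h2 : 2 * (μ * n ^ 3) = (n / 100) * (ρ * n ^ 2) := by rw [hμ]; ring
    rw [h2] at h1
    have h3 := le_of_mul_le_mul_right h1 (by positivity)
    have h4 := Finset.card_filter_add_card_filter_not (s := V) (fun z => f z ≤ ρ * n ^ 2)
    have h5 : (V'.card : ℝ) + ((V.filter fun z => ¬ f z ≤ ρ * n ^ 2).card : ℝ) = V.card := by
      exact_mod_cast h4
    linarith
  have hVn' : (V.card : ℝ) ≤ n := by linarith
  have hV'n : (V'.card : ℝ) ≤ n := by
    refine le_trans ?_ hVn'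
    exact_mod_cast Finset.card_le_card hV'V
  have hAne : A.Nonempty := Finset.card_pos.mp (by
    have : (0:ℝ) < A.card := by rw [hnA]; exact hn0
    exact_mod_cast this)
  obtain ⟨a1, ha1, hb1⟩ : ∃ a1 ∈ A, ((bet A V V (n / t ^ 2) a1).card : ℝ) ≤ μ * n ^ 2 := by
    by_contra hcon
    push Not at hcon
    have h1 : A.card • (μ * n ^ 2) < ∑ a ∈ A, ((bet A V V (n / t ^ 2) a).card : ℝ) := by
      rw [← Finset.sum_const]
      exact Finset.sum_lt_sum_of_nonempty hAne hcon
    have h2 : ∑ a ∈ A, ((bet A V V (n / t ^ 2) a).card : ℝ) = ∑ z ∈ V, (gg (n / t ^ 2) z : ℝ) := by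
      exact_mod_cast sum_bet A V V (n / t ^ 2)
    rw [h2, ← hpoor, nsmul_eq_mul, hnA] at h1
    nlinarith
  have hb1' : ((bet A V V' (n / t ^ 2) a1).card : ℝ) ≤ μ * n ^ 2 := by
    refine le_trans ?_ hb1
    have : bet A V V' (n / t ^ 2) a1 ⊆ bet A V V (n / t ^ 2) a1 :=
      Finset.filter_subset_filter _ (Finset.product_subset_product subset_rfl hV'V)
    exact_mod_cast Finset.card_le_card this
  have hs := sumS A V V' h0 hV'V a1 (n / t ^ 2)
  rw [hnA] at hs
  have hS : (((rich A V (n / t ^ 2) a1).erase 0).card : ℝ) ≤ n * t ^ 2 := by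
    have h1 := rich_card A V h0 (n / t ^ 2) a1
    have h2 : (((rich A V (n / t ^ 2) a1).erase 0).card : ℝ) ≤ (rich A V (n / t ^ 2) a1).card := by
      exact_mod_cast Finset.card_le_card (Finset.erase_subset _ _)
    refine h2.trans ?_
    have h3 : ((rich A V (n / t ^ 2) a1).card : ℝ) * (n / t ^ 2) ≤ (n * t ^ 2) * (n / t ^ 2) := by
      refine h1.trans ?_
      rw [hnA]
      have : n * t ^ 2 * (n / t ^ 2) = n * n := by field_simp
      rw [this]; gcongr
    exact le_of_mul_le_mul_right h3 (by positivity)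
  obtain ⟨X, hXV, hXc, hXu⟩ := findX A V' a1 n (t ^ 2) η (δ * (n / t ^ 2)) hn0 (by positivity) hη0 hV'n
    ((rich A V (n / t ^ 2) a1).erase 0) (Finset.notMem_erase _ _) hS
    (by
      have e1 : n * (n - 1 - n / 100) ≤ n * V'.card := by gcongr
      have e2 : μ * n ^ 2 ≤ 1 / 100 * n ^ 2 := by gcongr
      nlinarith)
    (by rw [hη, hδ]; norm_num)
  obtain ⟨Y, hYX, v0, hv0, c1, c2, c3⟩ := fromX A V X h0 (hXV.trans hV'V) a1 n t η δ _ hnA hn hVn' ht hη hδ rfl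
    hXc hXu
    (by
      intro z hz
      have := (Finset.mem_filter.mp (hXV hz)).2
      rw [le_div_iff₀ (by positivity)]
      have h2 : 0 ≤ t ^ 4 * (gg (n / t ^ 4) z : ℝ) := by positivity
      have h3 : t ^ 2 * (gg (n / t ^ 3) z : ℝ) + t ^ 4 * (gg (n / t ^ 4) z : ℝ) ≤ ρ * n ^ 2 := this
      show (gg (n / t ^ 3) z : ℝ) * t ^ 2 ≤ ρ * n ^ 2
      linarith)
    (by
      intro z hz
      have := (Finset.mem_filter.mp (hXV hz)).2
      rw [le_div_iff₀ (by positivity)]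
      have h2 : 0 ≤ t ^ 2 * (gg (n / t ^ 3) z : ℝ) := by positivity
      have h3 : t ^ 2 * (gg (n / t ^ 3) z : ℝ) + t ^ 4 * (gg (n / t ^ 4) z : ℝ) ≤ ρ * n ^ 2 := this
      show (gg (n / t ^ 4) z : ℝ) * t ^ 4 ≤ ρ * n ^ 2
      linarith)
  refine ⟨Y, hYX.trans (hXV.trans hV'V), v0, hV'V (hXV hv0), ?_, c2, c3⟩
  refine le_trans ?_ c1
  have : n / (8 * t ^ 2) = n / (4 * t ^ 2) / 2 := by field_simp; norm_num
  rw [this]; gcongr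

def Vb (A : Finset F) (b : F) : Finset F := (A.erase b).image fun y => (y - b)⁻¹

lemma Vb_inj (b : F) : Function.Injective fun y : F => (y - b)⁻¹ := by
  intro y y' h
  exact sub_left_injective (inv_injective h)

lemma mV_eq (A : Finset F) (a b s : F) : mV A (Vb A b) a s = mm A a b s := by
  unfold mV mm Vb
  rw [Finset.filter_image, Finset.card_image_of_injective _ (Vb_inj b)]
  simp only [div_inv_eq_mul]

lemma poor_sum (A : Finset F) (k : ℝ) : ∑ b ∈ A, poor A (Vb A b) k ≤
    (((A ×ˢ A) ×ˢ (A ×ˢ A)).filter fun p => p.2.2 ≠ p.1.2 ∧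
      (mm A p.1.1 p.1.2 ((p.2.1 - p.1.1) / (p.2.2 - p.1.2)) : ℝ) < k).card := by
  set Q := ((A ×ˢ A) ×ˢ (A ×ˢ A)).filter fun p => p.2.2 ≠ p.1.2 ∧
      (mm A p.1.1 p.1.2 ((p.2.1 - p.1.1) / (p.2.2 - p.1.2)) : ℝ) < k with hQ
  rw [Finset.card_eq_sum_card_fiberwise (f := fun p : (F × F) × (F × F) => p.1.2) (s := Q) (t := A)
    (fun p hp => by
      rw [hQ, Finset.mem_coe, Finset.mem_filter, Finset.mem_product, Finset.mem_product] at hp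
      exact Finset.mem_coe.mpr hp.1.1.2)]
  apply Finset.sum_le_sum
  intro b hb
  unfold poor
  apply Finset.card_le_card_of_injOn
    (fun p : (F × F) × F => (((p.1.1, b), (p.1.2, p.2⁻¹ + b)) : (F × F) × (F × F)))
  · intro p hp
    rw [Finset.mem_coe, Finset.mem_filter, Finset.mem_product, Finset.mem_product] at hp
    obtain ⟨⟨⟨p1, p2⟩, p3⟩, p4⟩ := hp
    rw [Vb, Finset.mem_image] at p3
    obtain ⟨y, hy, hy'⟩ := p3
    rw [Finset.mem_erase] at hy
    have e : p.2⁻¹ + b = y := by rw [← hy', inv_inv]; ring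
    rw [mV_eq] at p4
    rw [Finset.mem_coe, Finset.mem_filter, hQ, Finset.mem_filter, Finset.mem_product, Finset.mem_product,
      Finset.mem_product]
    refine ⟨⟨⟨⟨p1, hb⟩, p2, ?_⟩, ?_, ?_⟩, rfl⟩
    · show p.2⁻¹ + b ∈ A
      rw [e]; exact hy.2
    · show p.2⁻¹ + b ≠ b
      rw [e]; exact hy.1
    · show (mm A p.1.1 b ((p.1.2 - p.1.1) / (p.2⁻¹ + b - b)) : ℝ) < k
      rw [add_sub_cancel_right, div_inv_eq_mul]
      exact p4
  · intro p _ p' _ he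
    simp only [Prod.mk.injEq, add_left_inj, inv_inj, and_true, true_and] at he
    exact Prod.ext (Prod.ext he.1 he.2.1) he.2.2

lemma select_b [Fintype F] (A : Finset F) (n t μ : ℝ) (hnA : (A.card : ℝ) = n) (hn : 0 < n) (ht : 1 ≤ t)
    (hL : (numLines (A ×ˢ A) : ℝ) ≤ μ / 12 * t ^ 4 * n ^ 2) :
    ∃ b ∈ A, (poor A (Vb A b) (n / t ^ 2) : ℝ) ≤ μ * n ^ 3 ∧
      t ^ 2 * (poor A (Vb A b) (n / t ^ 3) : ℝ) ≤ μ * n ^ 3 ∧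
      t ^ 4 * (poor A (Vb A b) (n / t ^ 4) : ℝ) ≤ μ * n ^ 3 := by
  have ht0 : 0 < t := by linarith
  have hAne : A.Nonempty := Finset.card_pos.mp (by
    have : (0:ℝ) < A.card := by rw [hnA]; exact hn
    exact_mod_cast this)
  have hs : ∀ k : ℝ, ∑ b ∈ A, (poor A (Vb A b) k : ℝ) ≤ 4 * k ^ 2 * (μ / 12 * t ^ 4 * n ^ 2) := by
    intro k
    have h1 : ∑ b ∈ A, (poor A (Vb A b) k : ℝ) ≤ 4 * k ^ 2 * numLines (A ×ˢ A) := by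
      refine le_trans ?_ (poor_count A k)
      exact_mod_cast poor_sum A k
    refine h1.trans ?_
    gcongr
  let f : F → ℝ := fun b => (poor A (Vb A b) (n / t ^ 2) : ℝ) + t ^ 2 * (poor A (Vb A b) (n / t ^ 3) : ℝ) +
    t ^ 4 * (poor A (Vb A b) (n / t ^ 4) : ℝ)
  obtain ⟨b, hb, hfb⟩ : ∃ b ∈ A, f b ≤ μ * n ^ 3 := by
    by_contra hcon
    push Not at hcon
    have h1 : A.card • (μ * n ^ 3) < ∑ b ∈ A, f b := by
      rw [← Finset.sum_const]
      exact Finset.sum_lt_sum_of_nonempty hAne hcon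
    have h2 : ∑ b ∈ A, f b ≤ 4 * (n / t ^ 2) ^ 2 * (μ / 12 * t ^ 4 * n ^ 2) +
        t ^ 2 * (4 * (n / t ^ 3) ^ 2 * (μ / 12 * t ^ 4 * n ^ 2)) +
        t ^ 4 * (4 * (n / t ^ 4) ^ 2 * (μ / 12 * t ^ 4 * n ^ 2)) := by
      show ∑ b ∈ A, ((poor A (Vb A b) (n / t ^ 2) : ℝ) + t ^ 2 * (poor A (Vb A b) (n / t ^ 3) : ℝ) +
        t ^ 4 * (poor A (Vb A b) (n / t ^ 4) : ℝ)) ≤ _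
      rw [Finset.sum_add_distrib, Finset.sum_add_distrib, ← Finset.mul_sum, ← Finset.mul_sum]
      gcongr
      · exact hs _
      · exact hs _
      · exact hs _
    have h3 : 4 * (n / t ^ 2) ^ 2 * (μ / 12 * t ^ 4 * n ^ 2) +
        t ^ 2 * (4 * (n / t ^ 3) ^ 2 * (μ / 12 * t ^ 4 * n ^ 2)) +
        t ^ 4 * (4 * (n / t ^ 4) ^ 2 * (μ / 12 * t ^ 4 * n ^ 2)) = n * (μ * n ^ 3) := by
      field_simp; ring
    rw [nsmul_eq_mul, hnA] at h1
    linarith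
  have p0 : 0 ≤ (poor A (Vb A b) (n / t ^ 2) : ℝ) := by positivity
  have p2 : 0 ≤ t ^ 2 * (poor A (Vb A b) (n / t ^ 3) : ℝ) := by positivity
  have p1 : 0 ≤ t ^ 4 * (poor A (Vb A b) (n / t ^ 4) : ℝ) := by positivity
  have hfb' : (poor A (Vb A b) (n / t ^ 2) : ℝ) + t ^ 2 * (poor A (Vb A b) (n / t ^ 3) : ℝ) +
    t ^ 4 * (poor A (Vb A b) (n / t ^ 4) : ℝ) ≤ μ * n ^ 3 := hfb
  exact ⟨b, hb, by linarith, by linarith, by linarith⟩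

/-- trivial lower bound for the number of lines -/
lemma trivial_lines [Fintype F] (A : Finset F) (hA : 2 ≤ A.card) :
    (A.card : ℝ) ^ 2 / 8 ≤ numLines (A ×ˢ A) := by
  have h := poor_count A (A.card : ℝ)
  have hn : (2:ℝ) ≤ A.card := by exact_mod_cast hA
  have hsub : A.card * A.card * (A.card * (A.card - 1)) ≤ (((A ×ˢ A) ×ˢ (A ×ˢ A)).filter fun p => p.2.2 ≠ p.1.2 ∧
      (mm A p.1.1 p.1.2 ((p.2.1 - p.1.1) / (p.2.2 - p.1.2)) : ℝ) < (A.card : ℝ)).card := by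
    have h1 : ∀ p ∈ (A ×ˢ A) ×ˢ (A ×ˢ A),
        (mm A p.1.1 p.1.2 ((p.2.1 - p.1.1) / (p.2.2 - p.1.2)) : ℝ) < (A.card : ℝ) := by
      intro p hp
      rw [Finset.mem_product, Finset.mem_product] at hp
      have h2 : mm A p.1.1 p.1.2 ((p.2.1 - p.1.1) / (p.2.2 - p.1.2)) ≤ (A.erase p.1.2).card :=
        Finset.card_filter_le _ _
      have h3 := Finset.card_erase_lt_of_mem hp.1.2
      exact_mod_cast h2.trans_lt h3
    have h2 : (((A ×ˢ A) ×ˢ (A ×ˢ A)).filter fun p => p.2.2 ≠ p.1.2 ∧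
      (mm A p.1.1 p.1.2 ((p.2.1 - p.1.1) / (p.2.2 - p.1.2)) : ℝ) < (A.card : ℝ)) =
      ((A ×ˢ A) ×ˢ (A ×ˢ A)).filter fun p => p.2.2 ≠ p.1.2 := by
      apply Finset.filter_congr
      intro p hp
      exact ⟨fun h => h.1, fun h => ⟨h, h1 p hp⟩⟩
    rw [h2, card_filter_prod (A ×ˢ A) (A ×ˢ A) (fun u w => w.2 ≠ u.2)]
    rw [← Finset.card_product, ← smul_eq_mul]
    apply Finset.card_nsmul_le_sum
    intro u hu
    rw [Finset.mem_product] at hu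
    rw [← Finset.card_erase_of_mem hu.2, ← Finset.card_product]
    apply Finset.card_le_card
    intro w hw
    rw [Finset.mem_product, Finset.mem_erase] at hw
    rw [Finset.mem_filter, Finset.mem_product]
    exact ⟨⟨hw.1, hw.2.2⟩, hw.2.1⟩
  have hsub' : (A.card : ℝ) * A.card * (A.card * (A.card - 1)) ≤ 4 * (A.card : ℝ) ^ 2 * numLines (A ×ˢ A) := by
    refine le_trans ?_ h
    have e : ((A.card - 1 : ℕ) : ℝ) = (A.card : ℝ) - 1 := by
      rw [Nat.cast_sub (by omega)]; simp
    rw [← e]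
    exact_mod_cast hsub
  have h5 : (A.card : ℝ) * (A.card - 1) ≤ 4 * numLines (A ×ˢ A) := by
    have h6 : ((A.card : ℝ) * (A.card - 1)) * (A.card : ℝ) ^ 2 ≤ (4 * numLines (A ×ˢ A)) * (A.card : ℝ) ^ 2 := by
      nlinarith
    exact le_of_mul_le_mul_right h6 (by positivity)
  nlinarith

set_option maxHeartbeats 2000000 in
lemma core [Fintype F] (A : Finset F) (C n t q η δ μ : ℝ) (hC : 0 < C) (hnA : (A.card : ℝ) = n)
    (hqF : (Fintype.card F : ℝ) = q)
    (hη : η = 1 / 2000) (hδ : δ = 1 / 64000) (hμ : μ = η * δ ^ 2 / 16 / 200)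
    (ht : 10 ^ 150 * (1 + C) ^ 2 ≤ t) (htn : t ^ 208 ≤ n) (htq : t ^ 190 * n ≤ q)
    (hsf : subfieldCond A C (n ^ ((51:ℝ)/52)))
    (hL : (numLines (A ×ˢ A) : ℝ) ≤ μ / 12 * t ^ 4 * n ^ 2) : False := by
  have hC2 : 1 ≤ (1 + C) ^ 2 := by nlinarith
  have htE : (10:ℝ) ^ 150 ≤ t := by
    refine le_trans ?_ ht
    nlinarith [show (0:ℝ) < 10 ^ 150 by positivity]
  have ht100 : (100:ℝ) ≤ t := le_trans (by norm_num) htE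
  have ht1 : 1 ≤ t := by linarith
  have ht0 : 0 < t := by linarith
  have hn100 : 100 ≤ n := by
    have : t ≤ t ^ 208 := le_self_pow₀ ht1 (by norm_num)
    linarith
  have hn0 : 0 < n := by linarith
  obtain ⟨b, hb, H0, H2, H1⟩ := select_b A n t μ hnA hn0 ht1 hL
  have h0 : (0:F) ∉ Vb A b := by
    intro h
    rw [Vb, Finset.mem_image] at h
    obtain ⟨y, hy, he⟩ := h
    rw [Finset.mem_erase] at hy
    exact hy.1 (sub_eq_zero.mp (inv_eq_zero.mp he))
  have hVc : ((Vb A b).card : ℝ) + 1 = n := by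
    rw [← hnA, Vb, Finset.card_image_of_injective _ (Vb_inj b)]
    exact_mod_cast Finset.card_erase_add_one hb
  obtain ⟨Y, hYV, v0, hv0, hYc, hYd, hYw⟩ := fromV A (Vb A b) h0 n t η δ μ hnA hn100 hVc ht1 hη hδ hμ H0 H2 H1
  have hv00 : v0 ≠ 0 := fun h => h0 (h ▸ hv0)
  have hY0 : (0:F) ∉ Y := fun h => h0 (hYV h)
  set D : ℝ := 8 / δ with hD
  have hDv : D = 512000 := by rw [hD, hδ]; norm_num
  have hD0 : 0 < D := by rw [hDv]; norm_num
  set K : ℝ := 4 * (D * t ^ 10) ^ 2 with hK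
  set L : ℝ := 40 * (2 * (D * t ^ 12)) with hLd
  have hcov : Cov Y v0 L := by
    intro v hv Y1 hY1 hc
    obtain ⟨W, w1, w2⟩ := hYw v hv
    exact cover_lemma Y Y1 W v v0 hv00 (2 * (D * t ^ 12)) (by positivity) hY1 hc w1 w2
  have hYbig : t ^ 206 / 8 ≤ (Y.card : ℝ) := by
    refine le_trans ?_ hYc
    rw [div_le_div_iff₀ (by norm_num) (by positivity)]
    have : t ^ 206 * (8 * t ^ 2) = t ^ 208 * 8 := by ring
    rw [this]; linarith
  have hYn : (Y.card : ℝ) ≤ n := by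
    have : (Y.card : ℝ) ≤ (Vb A b).card := by exact_mod_cast Finset.card_le_card hYV
    linarith
  have hbig : ∀ (c : ℝ) (m : ℕ), m ≤ 205 → 0 ≤ c → c ≤ 10 ^ 149 * (1 + C) ^ 2 → c * t ^ m < Y.card := by
    intro c m hm hc0 hc
    refine lt_of_lt_of_le ?_ hYbig
    have h1 : t ^ m ≤ t ^ 205 := pow_le_pow_right₀ ht1 hm
    have h2 : c * t ^ m ≤ c * t ^ 205 := by gcongr
    have h3 : c < t / 8 := by
      have : (10:ℝ) ^ 150 * (1 + C) ^ 2 = 10 * (10 ^ 149 * (1 + C) ^ 2) := by ring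
      have h4 : 0 < (10:ℝ) ^ 149 * (1 + C) ^ 2 := by positivity
      linarith
    have h4 : c * t ^ 205 < t / 8 * t ^ 205 := by gcongr
    have h5 : t / 8 * t ^ 205 = t ^ 206 / 8 := by ring
    linarith
  have hEC : (10:ℝ) ^ 149 ≤ 10 ^ 149 * (1 + C) ^ 2 := le_mul_of_one_le_right (by positivity) hC2
  have hJ : L ^ 4 * K ^ 4 = ((80 * D) ^ 4 * (4 * D ^ 2) ^ 4) * t ^ 128 := by rw [hLd, hK]; ring
  have hJc : (80 * D) ^ 4 * (4 * D ^ 2) ^ 4 ≤ 10 ^ 140 := by rw [hDv]; norm_num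
  set c3 : ℝ := (80 * D) ^ 4 * (4 * D ^ 2) ^ 4 with hc3
  have hc30 : 0 < c3 := by positivity
  have hY2 : 2 ≤ Y.card := by
    have h := hbig 2 0 (by norm_num) (by norm_num) (le_trans (by norm_num) hEC)
    have : (2:ℝ) < Y.card := by simpa using h
    have : 2 < Y.card := by exact_mod_cast this
    omega
  obtain ⟨M, hMc, hMq⟩ := pivot Y v0 K L hY0 hY2 (by positivity) hYd hcov
    (by
      have e : 2 * L ^ 6 * K ^ 6 = (2 * (80 * D) ^ 6 * (4 * D ^ 2) ^ 6) * t ^ 192 := by rw [hLd, hK]; ring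
      rw [e]
      refine hbig _ _ (by norm_num) (by positivity) (le_trans ?_ hEC)
      rw [hDv]; norm_num)
    (by
      have e : 2 * L ^ 8 * K ^ 4 = (2 * (80 * D) ^ 8 * (4 * D ^ 2) ^ 4) * t ^ 176 := by rw [hLd, hK]; ring
      rw [e]
      refine hbig _ _ (by norm_num) (by positivity) (le_trans ?_ hEC)
      rw [hDv]; norm_num)
    (by
      rw [hJ, ← mul_assoc]
      refine (hbig _ _ (by norm_num) (by positivity) (le_trans ?_ hEC)).le
      linarith [show (8:ℝ) * 10 ^ 140 ≤ 10 ^ 149 by norm_num])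
  rw [hJ] at hMc
  have hYpos : (0:ℝ) < Y.card := by
    have : 0 < Y.card := by omega
    exact_mod_cast this
  by_cases hM : M = ⊤
  · have h1 : (Nat.card M : ℝ) = q := by
      rw [hM, ← hqF]
      have : Nat.card (⊤ : Subfield F) = Fintype.card F := by
        rw [Nat.card_congr Subfield.topEquiv.toEquiv, Nat.card_eq_fintype_card]
      exact_mod_cast this
    rw [h1] at hMc
    have h2 : 8 * (c3 * t ^ 128) * Y.card ≤ 8 * (c3 * t ^ 128) * n := by gcongr
    have h3 : t ^ 190 * n ≤ (8 * (c3 * t ^ 128)) * n := htq.trans (hMc.trans h2)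
    have h4 := le_of_mul_le_mul_right h3 hn0
    have h5 : t ^ 129 ≤ t ^ 190 := pow_le_pow_right₀ ht1 (by norm_num)
    have h6 : t * t ^ 128 ≤ (8 * c3) * t ^ 128 := by
      have : t * t ^ 128 = t ^ 129 := by ring
      rw [this]; linarith
    have h7 := le_of_mul_le_mul_right h6 (by positivity)
    linarith [show (8:ℝ) * 10 ^ 140 < 10 ^ 150 by norm_num]
  · obtain ⟨y0, hy0⟩ : Y.Nonempty := Finset.card_pos.mp (by omega)
    have hy00 : y0 ≠ 0 := fun h => hY0 (h ▸ hy0)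
    have h1 := hsf M hM y0⁻¹ b
    have h2 : Y.card ≤ (A.filter fun x => ∃ g ∈ M, x = y0⁻¹ * g + b).card := by
      apply Finset.card_le_card_of_injOn (fun y => y⁻¹ + b)
      · intro y hy
        have hy' := Finset.mem_coe.mp hy
        have hyne : y ≠ 0 := fun h => hY0 (h ▸ hy')
        rw [Finset.mem_coe, Finset.mem_filter]
        constructor
        · have := hYV hy'
          rw [Vb, Finset.mem_image] at this
          obtain ⟨w, hw, he⟩ := this
          show y⁻¹ + b ∈ A
          rw [← he, inv_inv, sub_add_cancel]
          exact Finset.mem_of_mem_erase hw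
        · refine ⟨y0 / y, hMq _ hy0 _ hy', ?_⟩
          show y⁻¹ + b = _
          field_simp
      · intro y _ y' _ he
        exact inv_injective (add_right_cancel (show y⁻¹ + b = y'⁻¹ + b from he))
    have h3 : (Y.card : ℝ) ≤ C * max ((Nat.card M : ℝ) ^ ((1:ℝ)/2)) (n ^ ((51:ℝ)/52)) := by
      refine le_trans (Nat.cast_le.mpr h2) (le_trans (le_of_eq ?_) h1)
      congr!
    rcases le_total ((Nat.card M : ℝ) ^ ((1:ℝ)/2)) (n ^ ((51:ℝ)/52)) with hle | hle
    · rw [max_eq_right hle] at h3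
      have e1 : n ^ ((51:ℝ)/52) * t ^ 4 ≤ n := by
        have h4 : t ^ 4 ≤ n ^ ((1:ℝ)/52) := by
          have : (t ^ 208) ^ ((1:ℝ)/52) ≤ n ^ ((1:ℝ)/52) := Real.rpow_le_rpow (by positivity) htn (by norm_num)
          refine le_trans (le_of_eq ?_) this
          rw [← Real.rpow_natCast t 208, ← Real.rpow_mul ht0.le, ← Real.rpow_natCast t 4]
          norm_num
        calc n ^ ((51:ℝ)/52) * t ^ 4 ≤ n ^ ((51:ℝ)/52) * n ^ ((1:ℝ)/52) := by gcongr
          _ = n := by rw [← Real.rpow_add hn0]; norm_num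
      have e2 : n ≤ 8 * t ^ 2 * Y.card := by
        rw [div_le_iff₀ (by positivity)] at hYc; linarith
      have e3 : (Y.card : ℝ) * t ^ 4 ≤ C * (8 * t ^ 2 * Y.card) := by
        calc (Y.card : ℝ) * t ^ 4 ≤ (C * n ^ ((51:ℝ)/52)) * t ^ 4 := by gcongr
          _ = C * (n ^ ((51:ℝ)/52) * t ^ 4) := by ring
          _ ≤ C * n := by gcongr
          _ ≤ _ := by gcongr
      have e4 : t ^ 2 * (t ^ 2 * Y.card) ≤ (8 * C) * (t ^ 2 * Y.card) := by
        have f1 : t ^ 2 * (t ^ 2 * (Y.card : ℝ)) = Y.card * t ^ 4 := by ring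
        have f2 : (8 * C) * (t ^ 2 * (Y.card : ℝ)) = C * (8 * t ^ 2 * Y.card) := by ring
        rw [f1, f2]; exact e3
      have e5 := le_of_mul_le_mul_right e4 (by positivity)
      have e6 : 8 * C < t := by
        refine lt_of_lt_of_le ?_ ht
        have f1 : (8:ℝ) * (1 + C) ^ 2 ≤ 10 ^ 150 * (1 + C) ^ 2 :=
          mul_le_mul_of_nonneg_right (by norm_num) (by positivity)
        refine lt_of_lt_of_le ?_ f1
        have f2 : 0 ≤ C ^ 2 := sq_nonneg C
        have f3 : (8:ℝ) * (1 + C) ^ 2 = 8 + 16 * C + 8 * C ^ 2 := by ring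
        rw [f3]; linarith
      have e7 : t ≤ t ^ 2 := le_self_pow₀ ht1 (by norm_num)
      linarith
    · rw [max_eq_left hle] at h3
      have e1 : (Y.card : ℝ) ^ 2 ≤ C ^ 2 * Nat.card M := by
        have h4 : ((Nat.card M : ℝ) ^ ((1:ℝ)/2)) ^ 2 = Nat.card M := by
          rw [← Real.sqrt_eq_rpow, Real.sq_sqrt (by positivity)]
        calc (Y.card : ℝ) ^ 2 ≤ (C * (Nat.card M : ℝ) ^ ((1:ℝ)/2)) ^ 2 := by gcongr
          _ = C ^ 2 * Nat.card M := by rw [mul_pow, h4]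
      have e2 : C ^ 2 * (Nat.card M : ℝ) ≤ C ^ 2 * (8 * (c3 * t ^ 128) * Y.card) := by gcongr
      have e3 : (Y.card : ℝ) * Y.card ≤ ((8 * c3 * C ^ 2) * t ^ 128) * Y.card := by
        have f1 : ((8 * c3 * C ^ 2) * t ^ 128) * (Y.card : ℝ) = C ^ 2 * (8 * (c3 * t ^ 128) * Y.card) := by ring
        rw [f1, ← pow_two]; exact e1.trans e2
      have e4 := le_of_mul_le_mul_right e3 hYpos
      have e5 := hbig (8 * c3 * C ^ 2) 128 (by norm_num) (by positivity) (by
        have h5 : 8 * c3 ≤ 10 ^ 149 := by linarith [show (8:ℝ) * 10 ^ 140 ≤ 10 ^ 149 by norm_num]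
        have h6 : C ^ 2 ≤ (1 + C) ^ 2 := by nlinarith
        gcongr)
      linarith

theorem stmt5 : ∀ C : ℝ, 0 < C → ∃ c' : ℝ, 0 < c' ∧
    ∀ (F : Type) [Field F] [Fintype F] (q : ℕ), IsPrimePow q → Fintype.card F = q →
    ∀ A : Finset F, 2 ≤ A.card →
    subfieldCond A C ((A.card : ℝ) ^ ((51:ℝ)/52)) →
    c' * min ((A.card : ℝ) ^ ((2:ℝ) + 1/52))
        ((q : ℝ) ^ ((2:ℝ)/95) * (A.card : ℝ) ^ ((2:ℝ) - 2/95)) ≤ (numLines (A ×ˢ A) : ℝ) := by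
  intro C hC
  set η : ℝ := 1 / 2000 with hη
  set δ : ℝ := 1 / 64000 with hδ
  set μ : ℝ := η * δ ^ 2 / 16 / 200 with hμ
  have hμ0 : 0 < μ := by rw [hμ, hη, hδ]; norm_num
  set t0 : ℝ := 10 ^ 150 * (1 + C) ^ 2 with ht0
  have ht00 : 0 < t0 := by positivity
  refine ⟨min (μ / 12) (1 / (8 * t0 ^ 4)), by positivity, ?_⟩
  intro F _ _ q _ hqF A hA hsf
  set c' : ℝ := min (μ / 12) (1 / (8 * t0 ^ 4)) with hc'
  have hc0 : 0 < c' := by positivity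
  by_contra hcon
  rw [not_le] at hcon
  set n : ℝ := (A.card : ℝ) with hn
  have hn2 : 2 ≤ n := by rw [hn]; exact_mod_cast hA
  have hn0 : 0 < n := by linarith
  have hqn : n ≤ (q : ℝ) := by
    rw [hn, ← hqF]; exact_mod_cast Finset.card_le_univ A
  have hq0 : (0:ℝ) < q := by linarith
  have hr1 : 1 ≤ (q : ℝ) / n := by rwa [one_le_div hn0]
  set t : ℝ := min (n ^ ((1:ℝ)/208)) (((q:ℝ) / n) ^ ((1:ℝ)/190)) with ht
  have ht1 : 1 ≤ t := le_min (Real.one_le_rpow (by linarith) (by norm_num))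
    (Real.one_le_rpow hr1 (by norm_num))
  have htpos : 0 < t := by linarith
  have htn : t ^ 208 ≤ n := by
    calc t ^ 208 ≤ (n ^ ((1:ℝ)/208)) ^ 208 := by gcongr; exact min_le_left _ _
      _ = n := by
        rw [← Real.rpow_natCast, ← Real.rpow_mul hn0.le]; norm_num
  have htq : t ^ 190 * n ≤ q := by
    have : t ^ 190 ≤ (q:ℝ) / n := by
      calc t ^ 190 ≤ (((q:ℝ) / n) ^ ((1:ℝ)/190)) ^ 190 := by gcongr; exact min_le_right _ _
        _ = (q:ℝ) / n := by
          rw [← Real.rpow_natCast, ← Real.rpow_mul (by positivity)]; norm_num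
    rwa [le_div_iff₀ hn0] at this
  have hmin : min (n ^ ((2:ℝ) + 1/52)) ((q : ℝ) ^ ((2:ℝ)/95) * n ^ ((2:ℝ) - 2/95)) ≤ t ^ 4 * n ^ 2 := by
    rcases min_choice (n ^ ((1:ℝ)/208)) (((q:ℝ) / n) ^ ((1:ℝ)/190)) with h | h
    · refine (min_le_left _ _).trans (le_of_eq ?_)
      rw [ht, h, ← Real.rpow_natCast (n ^ ((1:ℝ)/208)) 4, ← Real.rpow_mul hn0.le, ← Real.rpow_natCast n 2,
        ← Real.rpow_add hn0]
      congr 1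
      norm_num
    · refine (min_le_right _ _).trans (le_of_eq ?_)
      have hr0 : 0 ≤ (q:ℝ) / n := by linarith
      have e1 : t ^ 4 = ((q:ℝ) / n) ^ ((2:ℝ)/95) := by
        rw [ht, h, ← Real.rpow_natCast (((q:ℝ) / n) ^ ((1:ℝ)/190)) 4, ← Real.rpow_mul hr0]
        congr 1
        norm_num
      have e2 : n ^ (2:ℝ) = n ^ 2 := Real.rpow_ofNat n 2
      rw [e1, Real.div_rpow hq0.le hn0.le, Real.rpow_sub hn0, e2]
      ring
  have hL : (numLines (A ×ˢ A) : ℝ) < c' * (t ^ 4 * n ^ 2) :=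
    lt_of_lt_of_le hcon (by gcongr)
  rcases le_or_gt t0 t with h | h
  · refine core A C n t q η δ μ hC rfl (by rw [hqF]) hη hδ hμ h htn htq hsf ?_
    refine hL.le.trans ?_
    rw [← mul_assoc]
    gcongr
    exact min_le_left _ _
  · have h1 := trivial_lines A hA
    have h2 : c' * (t ^ 4 * n ^ 2) ≤ 1 / (8 * t0 ^ 4) * (t0 ^ 4 * n ^ 2) := by
      gcongr
      exact min_le_right _ _
    have h3 : 1 / (8 * t0 ^ 4) * (t0 ^ 4 * n ^ 2) = n ^ 2 / 8 := by
      field_simp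
    rw [h3] at h2
    linarith

end STP
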